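/- arXiv:math/0207304 — 3 statements merged into one kernel-verified Lean document; each statement's English description precedes it below -/
import Mathlib

section
/- Let p be a real number with p > 2. Let A be a relatively compact subset of ℓ^p with d(A) > 0. Then r(A) < 2^(−1/p) · d(A). -/
open scoped ENNReal

noncomputable def chebRadius {p : ℝ≥0∞} [Fact (1 ≤ p)]
    (A : Set (lp (fun _ : ℕ => ℝ) p)) : ℝ :=
  ⨅ y : lp (fun _ : ℕ => ℝ) p, ⨆ x : A, ‖(x : lp (fun _ : ℕ => ℝ) p) - y‖

open MeasureTheory Set in
/-- The absolute value raised to a power `q ∈ (0, 2)` is a positive mixture of the functions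
`t ↦ 1 - cos (t * s)`. -/
theorem exists_pos_mul_abs_rpow_eq_integral {q : ℝ} (hq0 : 0 < q) (hq2 : q < 2) :
    ∃ C : ℝ, 0 < C ∧ ∀ t : ℝ,
      IntegrableOn (fun s : ℝ => (1 - Real.cos (t * s)) * s ^ (-1 - q)) (Ioi 0) ∧
      C * |t| ^ q = ∫ s in Ioi (0 : ℝ), (1 - Real.cos (t * s)) * s ^ (-1 - q) := by
  have hint : ∀ t : ℝ,
      IntegrableOn (fun s : ℝ => (1 - Real.cos (t * s)) * s ^ (-1 - q)) (Ioi 0) := by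
    intro t
    have hmeas : Measurable fun s : ℝ => (1 - Real.cos (t * s)) * s ^ (-1 - q) := by
      fun_prop
    rw [← Ioc_union_Ioi_eq_Ioi zero_le_one]
    refine IntegrableOn.union ?_ ?_
    · have h1 : IntegrableOn (fun s : ℝ => t ^ 2 / 2 * s ^ (1 - q)) (Ioc 0 1) := by
        refine Integrable.const_mul ?_ _
        exact (intervalIntegrable_iff_integrableOn_Ioc_of_le zero_le_one).1
          (intervalIntegral.intervalIntegrable_rpow' (by linarith))
      refine Integrable.mono' h1 hmeas.aestronglyMeasurable ?_
      filter_upwards [ae_restrict_mem measurableSet_Ioc] with s hs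
      have hpow : s ^ (1 - q) = s ^ 2 * s ^ (-1 - q) := by
        rw [← Real.rpow_natCast, ← Real.rpow_add hs.1]
        norm_num
        ring_nf
      have hnn : 0 ≤ s ^ (-1 - q) := Real.rpow_nonneg hs.1.le _
      have hcos := Real.one_sub_sq_div_two_le_cos (x := t * s)
      rw [Real.norm_of_nonneg (mul_nonneg (by linarith [Real.cos_le_one (t * s)]) hnn), hpow,
        ← mul_assoc]
      exact mul_le_mul_of_nonneg_right (by nlinarith) hnn
    · have h1 : IntegrableOn (fun s : ℝ => 2 * s ^ (-1 - q)) (Ioi 1) :=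
        ((integrableOn_Ioi_rpow_iff zero_lt_one).2 (by linarith)).const_mul _
      refine Integrable.mono' h1 hmeas.aestronglyMeasurable ?_
      filter_upwards [ae_restrict_mem measurableSet_Ioi] with s hs
      have hnn : 0 ≤ s ^ (-1 - q) := Real.rpow_nonneg (zero_lt_one.trans hs).le _
      rw [Real.norm_of_nonneg (mul_nonneg (by linarith [Real.cos_le_one (t * s)]) hnn)]
      exact mul_le_mul_of_nonneg_right (by linarith [Real.neg_one_le_cos (t * s)]) hnn
  refine ⟨∫ s in Ioi (0 : ℝ), (1 - Real.cos (1 * s)) * s ^ (-1 - q), ?_, fun t => ⟨hint t, ?_⟩⟩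
  · have hnn : ∀ s ∈ Ioi (0 : ℝ), 0 ≤ (1 - Real.cos (1 * s)) * s ^ (-1 - q) := fun s hs =>
      mul_nonneg (by linarith [Real.cos_le_one (1 * s)]) (Real.rpow_nonneg (le_of_lt hs) _)
    rw [setIntegral_pos_iff_support_of_nonneg_ae
      ((ae_restrict_iff' measurableSet_Ioi).2 (Filter.Eventually.of_forall hnn)) (hint 1)]
    refine lt_of_lt_of_le (b := volume (Ioo (0 : ℝ) 1)) (by simp) (measure_mono fun s hs => ?_)
    refine ⟨?_, hs.1⟩
    have h1 : Real.cos s < 1 := by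
      have := Real.cos_lt_cos_of_nonneg_of_le_pi le_rfl
        (by linarith [hs.2, Real.pi_gt_three]) hs.1
      simpa using this
    have h2 : 0 < s ^ (-1 - q) := Real.rpow_pos_of_pos hs.1 _
    simp only [Function.mem_support, one_mul]
    exact (mul_pos (by linarith) h2).ne'
  · have habs : ∀ s, Real.cos (t * s) = Real.cos (|t| * s) := fun s => by
      rcases abs_choice t with h | h <;> simp [h]
    simp_rw [habs]
    rcases (abs_nonneg t).eq_or_lt with h0 | h0
    · simp [← h0, Real.zero_rpow hq0.ne']
    · have hcomp := integral_comp_mul_left_Ioi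
        (fun s : ℝ => (1 - Real.cos (1 * s)) * s ^ (-1 - q)) 0 h0
      have hpow : |t| ^ q = |t|⁻¹ * |t| ^ (1 + q) := by
        rw [Real.rpow_add h0, Real.rpow_one, inv_mul_cancel_left₀ h0.ne']
      rw [mul_zero, smul_eq_mul] at hcomp
      rw [hpow, mul_comm, mul_right_comm, ← hcomp, ← integral_mul_const]
      refine setIntegral_congr_fun measurableSet_Ioi fun s hs => ?_
      have : |t| ^ (1 + q) * |t| ^ (-1 - q) = 1 := by
        rw [← Real.rpow_add h0]
        simp
      simp only [one_mul]
      rw [Real.mul_rpow h0.le (le_of_lt hs)]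
      linear_combination (1 - Real.cos (|t| * s)) * s ^ (-1 - q) * this

/-- The kernel `|a| ^ q + |b| ^ q - |a - b| ^ q` is positive semidefinite for `q ∈ (0, 2)`. -/
theorem sum_mul_abs_rpow_add_sub_nonneg {ι : Type*} [Fintype ι] {q : ℝ} (hq0 : 0 < q)
    (hq2 : q < 2) (w a : ι → ℝ) :
    0 ≤ ∑ i, ∑ j, w i * w j * (|a i| ^ q + |a j| ^ q - |a i - a j| ^ q) := by
  obtain ⟨C, hC, hrep⟩ := exists_pos_mul_abs_rpow_eq_integral hq0 hq2
  refine nonneg_of_mul_nonneg_right (a := C) ?_ hC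
  have hterm : ∀ i j, MeasureTheory.IntegrableOn (fun s : ℝ => w i * w j *
      ((1 - Real.cos (a i * s)) * s ^ (-1 - q) + (1 - Real.cos (a j * s)) * s ^ (-1 - q)
        - (1 - Real.cos ((a i - a j) * s)) * s ^ (-1 - q))) (Set.Ioi 0) := fun i j =>
    (((hrep (a i)).1.add (hrep (a j)).1).sub (hrep (a i - a j)).1).const_mul _
  have heq : C * ∑ i, ∑ j, w i * w j * (|a i| ^ q + |a j| ^ q - |a i - a j| ^ q) =
      ∫ s in Set.Ioi (0 : ℝ), ∑ i, ∑ j, w i * w j *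
        ((1 - Real.cos (a i * s)) * s ^ (-1 - q) + (1 - Real.cos (a j * s)) * s ^ (-1 - q)
          - (1 - Real.cos ((a i - a j) * s)) * s ^ (-1 - q)) := by
    rw [MeasureTheory.integral_finsetSum _ fun i _ =>
      MeasureTheory.integrable_finsetSum _ fun j _ => hterm i j, Finset.mul_sum]
    refine Finset.sum_congr rfl fun i _ => ?_
    rw [MeasureTheory.integral_finsetSum _ fun j _ => hterm i j, Finset.mul_sum]
    refine Finset.sum_congr rfl fun j _ => ?_
    rw [MeasureTheory.integral_const_mul,
      MeasureTheory.integral_sub (by exact (hrep (a i)).1.add (hrep (a j)).1) (hrep (a i - a j)).1,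
      MeasureTheory.integral_add (hrep (a i)).1 (hrep (a j)).1,
      ← (hrep (a i)).2, ← (hrep (a j)).2, ← (hrep (a i - a j)).2]
    ring
  rw [heq]
  refine MeasureTheory.setIntegral_nonneg measurableSet_Ioi fun s hs => ?_
  have hsq : ∑ i, ∑ j, w i * w j *
        ((1 - Real.cos (a i * s)) * s ^ (-1 - q) + (1 - Real.cos (a j * s)) * s ^ (-1 - q)
          - (1 - Real.cos ((a i - a j) * s)) * s ^ (-1 - q)) =
      ((∑ i, w i * (1 - Real.cos (a i * s))) * (∑ j, w j * (1 - Real.cos (a j * s)))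
        + (∑ i, w i * Real.sin (a i * s)) * (∑ j, w j * Real.sin (a j * s))) *
          s ^ (-1 - q) := by
    simp_rw [Finset.sum_mul_sum, ← Finset.sum_add_distrib, Finset.sum_mul]
    refine Finset.sum_congr rfl fun i _ => Finset.sum_congr rfl fun j _ => ?_
    rw [sub_mul (a i), Real.cos_sub]
    ring
  rw [hsq]
  exact mul_nonneg (add_nonneg (mul_self_nonneg _) (mul_self_nonneg _))
    (Real.rpow_nonneg (le_of_lt hs) _)

theorem sum_mul_abs_sub_rpow_le {ι : Type*} [Fintype ι] {q : ℝ} (hq0 : 0 < q)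
    (hq2 : q < 2) {w : ι → ℝ} (hw : ∑ i, w i = 1) (a : ι → ℝ) :
    ∑ i, ∑ j, w i * w j * |a i - a j| ^ q ≤ 2 * ∑ i, w i * |a i| ^ q := by
  have h := sum_mul_abs_rpow_add_sub_nonneg hq0 hq2 w a
  have heq : ∑ i, ∑ j, w i * w j * (|a i| ^ q + |a j| ^ q - |a i - a j| ^ q) =
      (∑ i, w i * |a i| ^ q) * (∑ j, w j) + (∑ i, w i) * (∑ j, w j * |a j| ^ q)
        - ∑ i, ∑ j, w i * w j * |a i - a j| ^ q := by
    simp_rw [Finset.sum_mul_sum, ← Finset.sum_add_distrib, ← Finset.sum_sub_distrib]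
    refine Finset.sum_congr rfl fun i _ => Finset.sum_congr rfl fun j _ => ?_
    ring
  rw [heq, hw] at h
  linarith

theorem four_mul_sum_abs_rpow_le {ι : Type*} [Fintype ι] {p : ℝ} (hp : 2 < p) {w : ι → ℝ}
    (hw : w ∈ stdSimplex ℝ ι) (a : ι → ℝ) :
    4 * ∑ i, w i * |a i| ^ p ≤
      ∑ i, ∑ j, w i * w j * |a i - a j| ^ p + 2 * ∑ i, w i * |a i + ∑ j, w j * a j| ^ p := by
  have hp1 : 1 < p := by linarith
  have hpq : p.HolderConjugate (p / (p - 1)) := Real.HolderConjugate.conjExponent hp1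
  set q := p / (p - 1) with hq
  have hq2 : q < 2 := by
    rw [hq, div_lt_iff₀ (by linarith)]
    linarith
  have hinv : 1 / q = 1 - 1 / p := by
    rw [hq]
    field_simp
  set φ : ℝ → ℝ := fun t => SignType.sign t * |t| ^ (p - 1) with hφ
  have hφ_abs : ∀ t, |φ t| ^ q = |t| ^ p := fun t => by
    rcases eq_or_ne t 0 with rfl | ht
    · simp [hφ, Real.zero_rpow hpq.symm.ne_zero, Real.zero_rpow hpq.ne_zero]
    · have hs : |((SignType.sign t : SignType) : ℝ)| = 1 := by
        rcases ht.lt_or_gt with h | h <;> simp [h]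
      rw [hφ]
      simp only
      rw [abs_mul, hs, one_mul, abs_of_nonneg (by positivity), ← Real.rpow_mul (abs_nonneg t), hq]
      congr 1
      field_simp [show p - 1 ≠ 0 by linarith]
  have hφ_mul : ∀ t, φ t * t = |t| ^ p := fun t => by
    rcases eq_or_ne t 0 with rfl | ht
    · simp [Real.zero_rpow hpq.ne_zero]
    · rw [hφ]
      simp only
      rw [mul_right_comm, sign_mul_self, ← Real.rpow_one_add' (abs_nonneg t) (by linarith)]
      ring_nf
  have hyoung : ∀ s t : ℝ, p * (s * t) ≤ |s| ^ p + (p - 1) * |t| ^ q := fun s t => by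
    have h := mul_le_mul_of_nonneg_left (Real.young_inequality s t hpq) hpq.nonneg
    rw [div_eq_mul_one_div (|t| ^ q), hinv] at h
    refine h.trans_eq ?_
    field_simp
  obtain ⟨hw0, hw1⟩ := hw
  set m := ∑ j, w j * a j with hm
  have h1 : ∑ i, w i * (p * ((a i + m) * φ (a i))) ≤
      ∑ i, w i * (|a i + m| ^ p + (p - 1) * |φ (a i)| ^ q) :=
    Finset.sum_le_sum fun i _ => mul_le_mul_of_nonneg_left (hyoung _ _) (hw0 i)
  have h2 : ∑ i, ∑ j, w i * w j * (p * ((a i - a j) * (φ (a i) - φ (a j)))) ≤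
      ∑ i, ∑ j, w i * w j * (|a i - a j| ^ p + (p - 1) * |φ (a i) - φ (a j)| ^ q) :=
    Finset.sum_le_sum fun i _ => Finset.sum_le_sum fun j _ =>
      mul_le_mul_of_nonneg_left (hyoung _ _) (mul_nonneg (hw0 i) (hw0 j))
  have h3 := sum_mul_abs_sub_rpow_le hpq.symm.pos hq2 hw1 fun i => φ (a i)
  have e1 : ∑ i, w i * (p * ((a i + m) * φ (a i))) =
      p * (∑ i, w i * |a i| ^ p) + p * m * ∑ i, w i * φ (a i) := by
    simp_rw [Finset.mul_sum, ← Finset.sum_add_distrib, ← hφ_mul]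
    exact Finset.sum_congr rfl fun i _ => by ring
  have e2 : ∑ i, w i * (|a i + m| ^ p + (p - 1) * |φ (a i)| ^ q) =
      ∑ i, w i * |a i + m| ^ p + (p - 1) * ∑ i, w i * |a i| ^ p := by
    simp_rw [Finset.mul_sum, ← Finset.sum_add_distrib, hφ_abs]
    exact Finset.sum_congr rfl fun i _ => by ring
  have e3 : ∑ i, ∑ j, w i * w j * (p * ((a i - a j) * (φ (a i) - φ (a j)))) =
      p * ((∑ i, w i * |a i| ^ p) * (∑ j, w j) + (∑ i, w i) * (∑ j, w j * |a j| ^ p)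
        - (∑ i, w i * φ (a i)) * (∑ j, w j * a j)
        - (∑ i, w i * a i) * (∑ j, w j * φ (a j))) := by
    simp_rw [Finset.sum_mul_sum, ← Finset.sum_add_distrib, ← Finset.sum_sub_distrib,
      Finset.mul_sum, ← hφ_mul]
    exact Finset.sum_congr rfl fun i _ => Finset.sum_congr rfl fun j _ => by ring
  have e4 : ∑ i, ∑ j, w i * w j * (|a i - a j| ^ p + (p - 1) * |φ (a i) - φ (a j)| ^ q) =
      ∑ i, ∑ j, w i * w j * |a i - a j| ^ p +
        (p - 1) * ∑ i, ∑ j, w i * w j * |φ (a i) - φ (a j)| ^ q := by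
    simp_rw [Finset.mul_sum, ← Finset.sum_add_distrib]
    exact Finset.sum_congr rfl fun i _ => Finset.sum_congr rfl fun j _ => by ring
  simp_rw [hφ_abs] at h3
  rw [e1, e2] at h1
  rw [e3, e4, hw1, ← hm] at h2
  have h4 := mul_le_mul_of_nonneg_left h3 (show 0 ≤ p - 1 by linarith)
  linarith

theorem lp.four_mul_sum_norm_rpow_le {α ι : Type*} [Fintype ι] {p : ℝ} (hp : 2 < p)
    {w : ι → ℝ} (hw : w ∈ stdSimplex ℝ ι) (a : ι → lp (fun _ : α => ℝ) (ENNReal.ofReal p)) :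
    4 * ∑ i, w i * ‖a i‖ ^ p ≤
      ∑ i, ∑ j, w i * w j * ‖a i - a j‖ ^ p + 2 * ∑ i, w i * ‖a i + ∑ j, w j • a j‖ ^ p := by
  have htr : (ENNReal.ofReal p).toReal = p := ENNReal.toReal_ofReal (by linarith)
  have hs : ∀ f : lp (fun _ : α => ℝ) (ENNReal.ofReal p),
      HasSum (fun k => |f k| ^ p) (‖f‖ ^ p) := fun f => by
    have := lp.hasSum_norm (by rw [htr]; linarith) f
    simpa only [htr, Real.norm_eq_abs] using this
  refine hasSum_le (fun k => four_mul_sum_abs_rpow_le hp hw fun i => a i k)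
    ((hasSum_sum fun i _ => (hs (a i)).mul_left (w i)).mul_left 4)
    ((hasSum_sum fun i _ => hasSum_sum fun j _ => ?_).add
      ((hasSum_sum fun i _ => ?_).mul_left 2))
  · exact (hs (a i - a j)).mul_left _
  · have := (hs (a i + ∑ j, w j • a j)).mul_left (w i)
    have heval : ∀ k, (∑ j, w j • a j : lp (fun _ : α => ℝ) (ENNReal.ofReal p)) k =
        ∑ j, w j * a j k := fun k => by
      rw [lp.coeFn_sum]
      exact Finset.sum_apply k _ _
    simpa only [lp.coeFn_add, Pi.add_apply, heval] using this

/-- A finite family in `ℓ^p` has a center whose distances to the family are controlled by the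
mean of the `p`-th powers of the mutual distances, for suitable weights. -/
theorem lp.exists_center_two_mul_norm_sub_rpow_le {α ι : Type*} [Fintype ι] [Nonempty ι] {p : ℝ}
    (hp : 2 < p) [Fact (1 ≤ ENNReal.ofReal p)]
    (x : ι → lp (fun _ : α => ℝ) (ENNReal.ofReal p)) :
    ∃ y, ∃ w ∈ stdSimplex ℝ ι, ∀ i,
      2 * ‖x i - y‖ ^ p ≤ ∑ i, ∑ j, w i * w j * ‖x i - x j‖ ^ p := by
  classical
  have hconv : ∀ i, ConvexOn ℝ Set.univ fun y => ‖x i - y‖ ^ p := fun i => by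
    refine ⟨convex_univ, fun y _ z _ s t hs ht hst => ?_⟩
    have h1 : ‖x i - (s • y + t • z)‖ ≤ s * ‖x i - y‖ + t * ‖x i - z‖ := by
      have : x i - (s • y + t • z) = s • (x i - y) + t • (x i - z) := by
        rw [smul_sub, smul_sub, sub_add_sub_comm, ← add_smul, hst, one_smul]
      rw [this]
      refine (norm_add_le _ _).trans_eq ?_
      rw [norm_smul, norm_smul, Real.norm_of_nonneg hs, Real.norm_of_nonneg ht]
    exact (Real.rpow_le_rpow (norm_nonneg _) h1 (by linarith)).trans
      ((convexOn_rpow (by linarith : (1 : ℝ) ≤ p)).2 (norm_nonneg _) (norm_nonneg _) hs ht hst)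
  obtain ⟨y, hy, w, hw, hsad⟩ := Sion.exists_isSaddlePointOn
    (X := convexHull ℝ (Set.range x)) (Y := stdSimplex ℝ ι)
    (f := fun y w => ∑ i, w i * ‖x i - y‖ ^ p)
    ((Set.range_nonempty x).convexHull) (convex_convexHull ℝ _)
    ((Set.finite_range x).isCompact_convexHull ℝ)
    (fun w _ => Continuous.continuousOn (by
      refine continuous_finsetSum _ fun i _ => continuous_const.mul ?_
      exact (continuous_const.sub continuous_id).norm.rpow_const fun _ => Or.inr (by linarith)) |>.lowerSemicontinuousOn)
    (fun w hw => by
      refine ConvexOn.quasiconvexOn ?_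
      refine ⟨convex_convexHull ℝ _, fun u _ v _ s t hs ht hst => ?_⟩
      simp only [smul_eq_mul, Finset.mul_sum, ← Finset.sum_add_distrib]
      refine Finset.sum_le_sum fun i _ => ?_
      have := mul_le_mul_of_nonneg_left
        ((hconv i).2 (Set.mem_univ u) (Set.mem_univ v) hs ht hst) (hw.1 i)
      simp only [smul_eq_mul] at this
      linarith)
    (convex_stdSimplex ℝ ι) ⟨_, single_mem_stdSimplex ℝ (Classical.arbitrary ι)⟩
    (isCompact_stdSimplex ℝ ι)
    (fun y _ => ContinuousOn.upperSemicontinuousOn (by fun_prop))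
    (fun y _ => by
      refine ConcaveOn.quasiconcaveOn ?_
      refine ⟨convex_stdSimplex ℝ ι, fun u _ v _ s t hs ht hst => ?_⟩
      simp only [smul_eq_mul, Finset.mul_sum, ← Finset.sum_add_distrib]
      refine Finset.sum_le_sum fun i _ => ?_
      simp only [Pi.add_apply, Pi.smul_apply, smul_eq_mul]
      exact le_of_eq (by ring))
  refine ⟨y, w, hw, fun i => ?_⟩
  set m := ∑ j, w j • x j with hm
  have hmX : m ∈ convexHull ℝ (Set.range x) :=
    (convex_convexHull ℝ _).sum_mem (fun j _ => hw.1 j) hw.2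
      fun j _ => subset_convexHull ℝ _ (Set.mem_range_self j)
  set z := (1 / 2 : ℝ) • y + (1 / 2 : ℝ) • m with hz
  have hzX : z ∈ convexHull ℝ (Set.range x) :=
    convex_convexHull ℝ _ hy hmX (by norm_num) (by norm_num) (by norm_num)
  have hyz : ∑ j, w j * ‖x j - y‖ ^ p ≤ ∑ j, w j * ‖x j - z‖ ^ p := hsad z hzX w hw
  have hiy : ‖x i - y‖ ^ p ≤ ∑ j, w j * ‖x j - y‖ ^ p := by
    simpa [Pi.single_apply] using hsad y hy (Pi.single i 1) (single_mem_stdSimplex ℝ i)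
  have hmean : ∑ j, w j • (x j - z) = z - y := by
    simp_rw [smul_sub]
    rw [Finset.sum_sub_distrib, ← Finset.sum_smul, hw.2, one_smul, ← hm, hz]
    module
  have hkey := lp.four_mul_sum_norm_rpow_le hp hw fun j => x j - z
  simp only [hmean, sub_sub_sub_cancel_right, sub_add_sub_cancel] at hkey
  linarith

theorem sum_mul_le_sub_div_card {ι κ : Type*} [Fintype ι] [Fintype κ] [Nonempty κ]
    {w : ι → ℝ} (hw : w ∈ stdSimplex ℝ ι) (c : ι → κ) {S : ι → ι → ℝ} {D δ : ℝ} (hδ : δ ≤ D)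
    (hD : ∀ i j, S i j ≤ D) (hc : ∀ i j, c i = c j → S i j ≤ δ) :
    ∑ i, ∑ j, w i * w j * S i j ≤ D - (D - δ) / Fintype.card κ := by
  classical
  set u : κ → ℝ := fun k => ∑ i, if c i = k then w i else 0 with hu
  have hsum : ∑ k, u k = 1 := by
    rw [hu, Finset.sum_comm]
    simpa using hw.2
  have hcs : 1 / (Fintype.card κ : ℝ) ≤ ∑ k, u k ^ 2 := by
    have h := sq_sum_le_card_mul_sum_sq (s := Finset.univ) (f := u)
    rw [hsum, one_pow, Finset.card_univ] at h
    rw [div_le_iff₀' (by exact_mod_cast Fintype.card_pos)]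
    exact h
  have hsq : ∑ k, u k ^ 2 = ∑ i, ∑ j, w i * w j * if c i = c j then 1 else 0 := by
    simp_rw [hu, sq, Finset.sum_mul_sum]
    rw [Finset.sum_comm]
    refine Finset.sum_congr rfl fun i _ => ?_
    rw [Finset.sum_comm]
    refine Finset.sum_congr rfl fun j _ => ?_
    simp [eq_comm]
  have hww : ∑ i, ∑ j, w i * w j = 1 := by
    rw [← Finset.sum_mul_sum, hw.2, one_mul]
  have hle : ∑ i, ∑ j, w i * w j * S i j ≤
      ∑ i, ∑ j, w i * w j * (D - (D - δ) * if c i = c j then 1 else 0) := by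
    refine Finset.sum_le_sum fun i _ => Finset.sum_le_sum fun j _ =>
      mul_le_mul_of_nonneg_left ?_ (mul_nonneg (hw.1 i) (hw.1 j))
    split_ifs with h
    · linarith [hc i j h]
    · linarith [hD i j]
  have heq : ∑ i, ∑ j, w i * w j * (D - (D - δ) * if c i = c j then 1 else 0) =
      D * ∑ i, ∑ j, w i * w j - (D - δ) * ∑ k, u k ^ 2 := by
    rw [hsq]
    simp_rw [Finset.mul_sum, ← Finset.sum_sub_distrib]
    exact Finset.sum_congr rfl fun i _ => Finset.sum_congr rfl fun j _ => by ring
  rw [heq, hww] at hle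
  have h := mul_le_mul_of_nonneg_left hcs (sub_nonneg.2 hδ)
  rw [mul_one_div] at h
  linarith

theorem chebRadius_le_of_forall_norm_sub_le {p : ℝ≥0∞} [Fact (1 ≤ p)]
    {A : Set (lp (fun _ : ℕ => ℝ) p)} (hA : A.Nonempty) {y : lp (fun _ : ℕ => ℝ) p} {R : ℝ}
    (h : ∀ x ∈ A, ‖x - y‖ ≤ R) : chebRadius A ≤ R := by
  have : Nonempty A := hA.to_subtype
  refine (ciInf_le ⟨0, ?_⟩ y).trans (ciSup_le fun x => h x x.2)
  rintro _ ⟨z, rfl⟩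
  exact Real.iSup_nonneg fun x => norm_nonneg _

theorem gulevich_large_p (p : ℝ) (hp : 2 < p) [Fact (1 ≤ ENNReal.ofReal p)]
    (A : Set (lp (fun _ : ℕ => ℝ) (ENNReal.ofReal p)))
    (hcpt : IsCompact (closure A)) (hd : 0 < Metric.diam A) :
    chebRadius A < 2 ^ (-(1 / p)) * Metric.diam A := by
  have hp0 : 0 < p := by linarith
  have htb : TotallyBounded A := hcpt.totallyBounded.subset subset_closure
  have hbdd : Bornology.IsBounded A := hcpt.isBounded.subset subset_closure
  have hne : A.Nonempty := by
    by_contra h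
    simp [Set.not_nonempty_iff_eq_empty.1 h] at hd
  set d := Metric.diam A with hd_def
  obtain ⟨t, -, htfin, htcov⟩ := Metric.finite_approx_of_totallyBounded htb (d / 4) (by linarith)
  have : Fintype t := htfin.fintype
  have hcov : ∀ x ∈ A, ∃ k : t, dist x k < d / 4 := fun x hx => by
    obtain ⟨k, hk, hxk⟩ := Set.mem_iUnion₂.1 (htcov hx)
    exact ⟨⟨k, hk⟩, hxk⟩
  have : Nonempty t := let ⟨k, _⟩ := hcov _ hne.some_mem; ⟨k⟩
  have hlt : (d / 2) ^ p < d ^ p := Real.rpow_lt_rpow (by linarith) (by linarith) hp0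
  set T := d ^ p - (d ^ p - (d / 2) ^ p) / Fintype.card t with hT
  have hcard : (1 : ℝ) ≤ Fintype.card t := by exact_mod_cast Fintype.card_pos
  have hTlt : T < d ^ p := by
    have : 0 < (d ^ p - (d / 2) ^ p) / Fintype.card t := div_pos (by linarith) (by linarith)
    linarith
  have hT0 : 0 ≤ T := by
    have h1 : (d ^ p - (d / 2) ^ p) / Fintype.card t ≤ d ^ p - (d / 2) ^ p :=
      div_le_self (by linarith) hcard
    have h2 : 0 ≤ (d / 2) ^ p := by positivity
    linarith
  have hle : chebRadius A ≤ (T / 2) ^ (1 / p) := by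
    refine le_of_forall_pos_le_add fun ε hε => ?_
    obtain ⟨s, hsA, hsfin, hscov⟩ := Metric.finite_approx_of_totallyBounded htb ε hε
    have : Fintype s := hsfin.fintype
    have : Nonempty s := by
      obtain ⟨k, hk, -⟩ := Set.mem_iUnion₂.1 (hscov hne.some_mem)
      exact ⟨⟨k, hk⟩⟩
    obtain ⟨y, w, hw, hy⟩ := lp.exists_center_two_mul_norm_sub_rpow_le hp
      (Subtype.val : s → lp (fun _ : ℕ => ℝ) (ENNReal.ofReal p))
    choose c hc using fun i : s => hcov i (hsA i.2)
    have hmean := sum_mul_le_sub_div_card hw c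
      (S := fun i j => ‖(i : lp (fun _ : ℕ => ℝ) (ENNReal.ofReal p)) - j‖ ^ p) hlt.le
      (fun i j => Real.rpow_le_rpow (norm_nonneg _)
        (by simpa [dist_eq_norm] using Metric.dist_le_diam_of_mem hbdd (hsA i.2) (hsA j.2)) hp0.le)
      (fun i j hij => by
        refine Real.rpow_le_rpow (norm_nonneg _) ?_ hp0.le
        have h1 := hc i
        have h2 := hc j
        rw [← hij] at h2
        rw [← dist_eq_norm]
        linarith [dist_triangle_right (i : lp (fun _ : ℕ => ℝ) (ENNReal.ofReal p)) j (c i)])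
    refine chebRadius_le_of_forall_norm_sub_le hne (y := y) fun x hx => ?_
    obtain ⟨k, hk, hxk⟩ := Set.mem_iUnion₂.1 (hscov hx)
    have hky : ‖k - y‖ ≤ (T / 2) ^ (1 / p) := by
      rw [one_div, Real.le_rpow_inv_iff_of_pos (norm_nonneg _) (by linarith) hp0]
      linarith [hy ⟨k, hk⟩]
    have hxk' : ‖x - k‖ < ε := by simpa [dist_eq_norm] using hxk
    linarith [norm_sub_le_norm_sub_add_norm_sub x k y]
  refine hle.trans_lt ?_
  have heq : 2 ^ (-(1 / p)) * d = (d ^ p / 2) ^ (1 / p) := by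
    rw [Real.div_rpow (by positivity) zero_le_two, ← Real.rpow_mul hd.le,
      mul_one_div_cancel hp0.ne', Real.rpow_one, Real.rpow_neg zero_le_two]
    ring
  rw [heq]
  exact Real.rpow_lt_rpow (by linarith) (by linarith) (by positivity)
end

section
/- Let p be a real number with 1 < p ≤ 2 and let q = p/(p−1). Let A be a bounded subset of ℓ^p containing at least two points which is extremal, i.e. r(A) = 2^(−1/q) · d(A). Then for every ε with 0 < ε < d(A) and every positive integer m, there exist points z_1, …, z_{m+1} ∈ A such that ‖z_i − z_j‖ ≥ d(A) − ε for all i ≠ j (i.e. A contains the vertex set of an m-simplex each of whose edges has length at least d(A) − ε). -/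
open scoped ENNReal

/-- The odd extension of `a ↦ a ^ s` to the real line. -/
noncomputable def signedRpow (s a : ℝ) : ℝ := max a 0 ^ s - max (-a) 0 ^ s

lemma signedRpow_of_nonneg {s a : ℝ} (hs : 0 < s) (ha : 0 ≤ a) : signedRpow s a = a ^ s := by
  simp [signedRpow, ha, Real.zero_rpow hs.ne']

lemma signedRpow_neg (s a : ℝ) : signedRpow s (-a) = -signedRpow s a := by
  simp [signedRpow]

lemma continuous_signedRpow {s : ℝ} (hs : 0 ≤ s) : Continuous (signedRpow s) := by
  unfold signedRpow
  exact ((continuous_id.max continuous_const).rpow_const fun _ => Or.inr hs).sub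
    ((continuous_neg.max continuous_const).rpow_const fun _ => Or.inr hs)

lemma signedRpow_nonneg {s a : ℝ} (hs : 0 < s) (ha : 0 ≤ a) : 0 ≤ signedRpow s a := by
  rw [signedRpow_of_nonneg hs ha]; positivity

lemma signedRpow_nonpos {s a : ℝ} (hs : 0 < s) (ha : a ≤ 0) : signedRpow s a ≤ 0 := by
  have := signedRpow_nonneg hs (neg_nonneg.2 ha)
  rw [signedRpow_neg] at this
  linarith

lemma signedRpow_mul_self {s : ℝ} (hs : 0 < s) (a : ℝ) :
    signedRpow s a * a = |a| ^ (s + 1) := by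
  have key : ∀ b : ℝ, 0 ≤ b → signedRpow s b * b = |b| ^ (s + 1) := fun b hb => by
    rw [signedRpow_of_nonneg hs hb, abs_of_nonneg hb,
      Real.rpow_add_of_nonneg hb hs.le zero_le_one, Real.rpow_one]
  rcases le_total 0 a with ha | ha
  · exact key a ha
  · have := key (-a) (neg_nonneg.2 ha)
    rwa [signedRpow_neg, neg_mul_neg, abs_neg] at this

lemma rpow_sub_rpow_le {s a b : ℝ} (hs : 0 < s) (hs1 : s ≤ 1) (hb : 0 ≤ b) (hab : b ≤ a) :
    a ^ s - b ^ s ≤ (a - b) ^ s := by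
  have := Real.rpow_add_le_add_rpow (sub_nonneg.2 hab) hb hs.le hs1
  rw [sub_add_cancel] at this
  linarith

lemma rpow_add_rpow_le {s a b : ℝ} (hs : 0 < s) (hs1 : s ≤ 1) (ha : 0 ≤ a) (hb : 0 ≤ b) :
    a ^ s + b ^ s ≤ 2 ^ (1 - s) * (a + b) ^ s := by
  have h := (Real.concaveOn_rpow hs.le hs1).2 (Set.mem_Ici.2 ha) (Set.mem_Ici.2 hb)
    (by norm_num : (0 : ℝ) ≤ 1 / 2) (by norm_num : (0 : ℝ) ≤ 1 / 2) (by norm_num)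
  simp only [smul_eq_mul] at h
  rw [← mul_add, ← mul_add, Real.mul_rpow (by norm_num) (by positivity), one_div,
    Real.inv_rpow (by norm_num)] at h
  rw [Real.rpow_sub (by norm_num), Real.rpow_one]
  have h2 : (0 : ℝ) < 2 ^ s := by positivity
  calc a ^ s + b ^ s = 2 * (2⁻¹ * (a ^ s + b ^ s)) := by ring
    _ ≤ 2 * ((2 ^ s)⁻¹ * (a + b) ^ s) := by gcongr
    _ = _ := by ring

/-- The odd power function of exponent `s ≤ 1` is `s`-Hölder with constant `2 ^ (1 - s)`. -/
lemma signedRpow_sub_le {s a b : ℝ} (hs : 0 < s) (hs1 : s ≤ 1) (hab : b ≤ a) :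
    signedRpow s a - signedRpow s b ≤ 2 ^ (1 - s) * (a - b) ^ s := by
  have h1 : (1 : ℝ) ≤ 2 ^ (1 - s) := Real.one_le_rpow (by norm_num) (by linarith)
  have same : ∀ x y : ℝ, 0 ≤ y → y ≤ x →
      signedRpow s x - signedRpow s y ≤ 2 ^ (1 - s) * (x - y) ^ s := fun x y hy hxy => by
    rw [signedRpow_of_nonneg hs hy, signedRpow_of_nonneg hs (hy.trans hxy)]
    have h0 : 0 ≤ (x - y) ^ s := Real.rpow_nonneg (sub_nonneg.2 hxy) _
    exact (rpow_sub_rpow_le hs hs1 hy hxy).trans (le_mul_of_one_le_left h0 h1)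
  rcases le_total 0 b with hb | hb
  · exact same a b hb hab
  rcases le_total 0 a with ha | ha
  · have h := rpow_add_rpow_le hs hs1 ha (neg_nonneg.2 hb)
    have hb' := signedRpow_neg s b
    rw [signedRpow_of_nonneg hs (neg_nonneg.2 hb)] at hb'
    rw [signedRpow_of_nonneg hs ha]
    rw [← sub_eq_add_neg a b] at h
    linarith
  · have h := same (-b) (-a) (neg_nonneg.2 ha) (neg_le_neg hab)
    rw [signedRpow_neg, signedRpow_neg] at h
    have e : -b - -a = a - b := by ring
    rw [e] at h
    linarith

lemma signedRpow_sub_mul_sub_le {s : ℝ} (hs : 0 < s) (hs1 : s ≤ 1) (a b : ℝ) :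
    (signedRpow s a - signedRpow s b) * (a - b) ≤ 2 ^ (1 - s) * |a - b| ^ (s + 1) := by
  have key : ∀ x y : ℝ, y ≤ x →
      (signedRpow s x - signedRpow s y) * (x - y) ≤ 2 ^ (1 - s) * |x - y| ^ (s + 1) := by
    intro x y hxy
    have h0 := sub_nonneg.2 hxy
    rw [abs_of_nonneg h0, Real.rpow_add_of_nonneg h0 hs.le zero_le_one, Real.rpow_one, ← mul_assoc]
    exact mul_le_mul_of_nonneg_right (signedRpow_sub_le hs hs1 hxy) h0
  rcases le_total b a with h | h
  · exact key a b h
  · have := key b a h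
    rw [abs_sub_comm] at this
    linarith

open Finset in
lemma sum_mul_sum_rpow_abs_sub_ge {ι : Type*} [Fintype ι] {s : ℝ} (hs : 0 < s) (hs1 : s ≤ 1)
    {t : ι → ℝ} (ht : ∀ i, 0 ≤ t i) (ht1 : ∑ i, t i = 1) {u : ι → ℝ}
    (hu : ∑ i, t i * signedRpow s (u i) = 0) :
    2 * ∑ i, t i * |u i| ^ (s + 1) ≤
      2 ^ (1 - s) * ∑ i, ∑ j, t i * t j * |u i - u j| ^ (s + 1) := by
  have expand : ∑ i, ∑ j, t i * t j * ((signedRpow s (u i) - signedRpow s (u j)) * (u i - u j)) =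
      2 * ∑ i, t i * |u i| ^ (s + 1) := by
    have e : ∀ i j, t i * t j * ((signedRpow s (u i) - signedRpow s (u j)) * (u i - u j)) =
        t i * |u i| ^ (s + 1) * t j - t i * signedRpow s (u i) * (t j * u j)
          - t i * u i * (t j * signedRpow s (u j)) + t i * (t j * |u j| ^ (s + 1)) := fun i j => by
      rw [← signedRpow_mul_self hs, ← signedRpow_mul_self hs]; ring
    simp only [e, sum_add_distrib, sum_sub_distrib, ← mul_sum, ← sum_mul, hu, ht1]
    ring
  rw [← expand, mul_sum]
  refine sum_le_sum fun i _ => ?_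
  rw [mul_sum]
  refine sum_le_sum fun j _ => ?_
  rw [mul_left_comm (2 ^ (1 - s))]
  exact mul_le_mul_of_nonneg_left (signedRpow_sub_mul_sub_le hs hs1 _ _)
    (mul_nonneg (ht i) (ht j))

open Finset in
lemma exists_sum_signedRpow_sub_eq_zero {ι : Type*} [Fintype ι] {s : ℝ} (hs : 0 < s)
    {t : ι → ℝ} (ht : ∀ i, 0 ≤ t i) (x : ι → ℝ) :
    ∃ y : ℝ, |y| ≤ ∑ i, |x i| ∧ ∑ i, t i * signedRpow s (x i - y) = 0 := by
  set M := ∑ i, |x i|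
  have hM : 0 ≤ M := sum_nonneg fun _ _ => abs_nonneg _
  have hx : ∀ i, |x i| ≤ M := fun i =>
    single_le_sum (f := fun i => |x i|) (fun _ _ => abs_nonneg _) (mem_univ i)
  have hc : Continuous fun y : ℝ => ∑ i, t i * signedRpow s (x i - y) :=
    continuous_finsetSum _ fun i _ => continuous_const.mul
      ((continuous_signedRpow hs.le).comp (continuous_const.sub continuous_id))
  have h := intermediate_value_Icc' (neg_le_self hM) hc.continuousOn (a := -M) (b := M)
  obtain ⟨y, hy, hy0⟩ := h (a := 0) ⟨
    sum_nonpos fun i _ => mul_nonpos_of_nonneg_of_nonpos (ht i)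
      (signedRpow_nonpos hs (by linarith [(abs_le.1 (hx i)).2])),
    sum_nonneg fun i _ => mul_nonneg (ht i)
      (signedRpow_nonneg hs (by linarith [(abs_le.1 (hx i)).1]))⟩
  exact ⟨y, abs_le.2 hy, hy0⟩

open Finset in
/-- If the pairs related by `bad` have small total weight, there are `n` pairwise unrelated
indices. -/
lemma exists_pairwise_not_of_weight_le {ι : Type*} [Fintype ι] {t : ι → ℝ} (ht : ∀ i, 0 ≤ t i)
    (ht1 : ∑ i, t i = 1) (bad : ι → ι → Prop) (hsymm : ∀ i j, bad i j → bad j i) {β : ℝ}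
    (hβ : 0 < β) [∀ i j, Decidable (bad i j)]
    (hbad : ∑ i, ∑ j, t i * t j * (if bad i j then 1 else 0) ≤ β ^ 2) (n : ℕ) (hn : n * β < 1) :
    ∃ z : Fin n → ι, ∀ a b, a ≠ b → ¬ bad (z a) (z b) := by
  classical
  set D : ι → ℝ := fun i => ∑ j, t j * (if bad i j then 1 else 0)
  have hD : ∀ i, 0 ≤ D i := fun i => sum_nonneg fun j _ => mul_nonneg (ht j) (by split_ifs <;> simp)
  have hDsum : ∑ i, t i * D i ≤ β ^ 2 := by
    simpa only [D, mul_sum, mul_assoc] using hbad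
  have hheavy : ∑ i, t i * (if β < D i then 1 else 0) ≤ β := by
    refine le_of_mul_le_mul_right ?_ hβ
    rw [sum_mul, ← pow_two]
    refine (sum_le_sum fun i _ => ?_).trans hDsum
    rw [mul_assoc]
    refine mul_le_mul_of_nonneg_left ?_ (ht i)
    split_ifs with h
    · linarith
    · simpa using hD i
  suffices ∃ z : Fin n → ι, (∀ a, D (z a) ≤ β) ∧ ∀ a b, a ≠ b → ¬ bad (z a) (z b) by
    obtain ⟨z, -, hz⟩ := this
    exact ⟨z, hz⟩
  induction n with
  | zero => exact ⟨Fin.elim0, fun a => a.elim0, fun a => a.elim0⟩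
  | succ n ih =>
    push_cast at hn
    obtain ⟨z, hzD, hz⟩ := ih (by linarith)
    obtain ⟨i, hi⟩ : ∃ i, ¬ β < D i ∧ ∀ a, ¬ bad (z a) i := by
      by_contra! hcon
      have hle : ∑ i, t i ≤
          ∑ i, t i * ((if β < D i then 1 else 0) + ∑ a, if bad (z a) i then 1 else 0) := by
        refine sum_le_sum fun i _ => le_mul_of_one_le_right (ht i) ?_
        have h0 : ∀ a ∈ univ, (0 : ℝ) ≤ if bad (z a) i then 1 else 0 := fun a _ => by
          split_ifs <;> simp
        by_cases h : β < D i
        · simp [h]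
        · obtain ⟨a, ha⟩ := hcon i (not_lt.1 h)
          have := single_le_sum h0 (mem_univ a)
          simpa [h, ha] using this
      have hle2 : ∑ i, t i * (∑ a, if bad (z a) i then (1 : ℝ) else 0) ≤ n * β := by
        simp only [mul_sum]
        rw [sum_comm]
        calc _ ≤ ∑ a : Fin n, β := sum_le_sum fun a _ => hzD a
          _ = n * β := by simp
      simp only [mul_add, sum_add_distrib] at hle
      linarith
    refine ⟨Fin.snoc z i, fun a => ?_, fun a b => ?_⟩
    · refine Fin.lastCases ?_ (fun a => ?_) a
      · simpa using not_lt.1 hi.1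
      · simpa using hzD a
    · refine Fin.lastCases ?_ (fun a => ?_) a <;> refine Fin.lastCases ?_ (fun b => ?_) b
      · simp
      · simpa using fun _ h => hi.2 b (hsymm _ _ h)
      · simpa using hi.2 a
      · simpa using hz a b

open Finset in
/-- A finite family of convex functions without a common point where all are at most `c` admits a
convex combination that is everywhere at least `c`. -/
lemma exists_convex_combination_ge {E ι : Type*} [AddCommGroup E] [Module ℝ E] [Fintype ι]
    {f : ι → E → ℝ} (hf : ∀ i, ConvexOn ℝ Set.univ (f i)) {c : ℝ} (hc : ∀ y, ∃ i, c < f i y) :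
    ∃ t : ι → ℝ, (∀ i, 0 ≤ t i) ∧ ∑ i, t i = 1 ∧ ∀ y, c ≤ ∑ i, t i * f i y := by
  classical
  set S : Set (ι → ℝ) := {v | ∃ y, ∀ i, f i y - c < v i}
  have hSc : Convex ℝ S := by
    rintro v ⟨y, hy⟩ w ⟨z, hz⟩ a b ha hb hab
    refine ⟨a • y + b • z, fun i => ?_⟩
    have h := (hf i).2 (Set.mem_univ y) (Set.mem_univ z) ha hb hab
    have h2 : a * (f i y - c) + b * (f i z - c) < a * v i + b * w i := by
      rcases ha.eq_or_lt with rfl | ha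
      · have : b = 1 := by linarith
        subst this; simpa using hz i
      · exact add_lt_add_of_lt_of_le (mul_lt_mul_of_pos_left (hy i) ha)
          (mul_le_mul_of_nonneg_left (hz i).le hb)
    simp only [Pi.add_apply, Pi.smul_apply, smul_eq_mul] at h ⊢
    have h3 : a * c + b * c = c := by rw [← add_mul, hab, one_mul]
    linarith
  have hSo : IsOpen S := by
    have : S = ⋃ y, Set.univ.pi fun i => Set.Ioi (f i y - c) := by
      ext v; simp [S]
    rw [this]
    exact isOpen_iUnion fun y => isOpen_set_pi Set.finite_univ fun i _ => isOpen_Ioi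
  have h0 : (0 : ι → ℝ) ∉ S := by
    rintro ⟨y, hy⟩
    obtain ⟨i, hi⟩ := hc y
    have := hy i
    simp only [Pi.zero_apply] at this
    linarith
  obtain ⟨g, hg⟩ := geometric_hahn_banach_open_point hSc hSo h0
  set τ : ι → ℝ := fun i => -g (Pi.single i 1)
  have hgτ : ∀ v, g v = -∑ i, τ i * v i := fun v => by
    have := LinearMap.pi_apply_eq_sum_univ (g : (ι → ℝ) →ₗ[ℝ] ℝ) v
    have e : ∀ i : ι, (fun j => if i = j then (1 : ℝ) else 0) = Pi.single i 1 := fun i => by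
      ext j
      rw [Pi.single_apply]
      exact if_congr eq_comm rfl rfl
    simp only [e, ContinuousLinearMap.coe_coe, smul_eq_mul] at this
    rw [this]
    simp [τ, mul_comm]
  have hpos : ∀ v ∈ S, 0 < ∑ i, τ i * v i := fun v hv => by
    have := hg v hv
    rw [map_zero, hgτ] at this
    linarith
  set v₀ : ι → ℝ := fun i => f i 0 - c + 1
  have hv₀ : v₀ ∈ S := ⟨0, fun i => by simp [v₀]⟩
  have hτ : ∀ i, 0 ≤ τ i := fun i => by
    by_contra! hneg
    set K := (∑ j, τ j * v₀ j) / (-τ i)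
    have hK : 0 ≤ K := div_nonneg (hpos _ hv₀).le (by linarith)
    have hmem : v₀ + Pi.single i K ∈ S := ⟨0, fun j => by
      have : 0 ≤ (Pi.single i K : ι → ℝ) j := by
        by_cases h : j = i
        · subst h; simpa
        · simp [h]
      simp only [Pi.add_apply, v₀]; linarith⟩
    have h := hpos _ hmem
    simp only [Pi.add_apply, mul_add, sum_add_distrib, Pi.single_apply, mul_ite, mul_zero,
      sum_ite_eq', mem_univ, if_true] at h
    have : τ i * K = -∑ j, τ j * v₀ j := by
      simp only [K, div_neg, mul_neg, mul_div_cancel₀ _ hneg.ne]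
    linarith
  have hT : 0 < ∑ i, τ i := by
    refine (sum_nonneg fun i _ => hτ i).lt_of_ne fun h => ?_
    have hz : ∀ i, τ i = 0 := fun i =>
      (sum_eq_zero_iff_of_nonneg fun i _ => hτ i).1 h.symm i (mem_univ i)
    have := hpos _ hv₀
    simp [hz] at this
  refine ⟨fun i => τ i / ∑ j, τ j, fun i => div_nonneg (hτ i) hT.le, ?_, fun y => ?_⟩
  · rw [← sum_div, div_self hT.ne']
  · have hη : ∀ η > 0, c ≤ ∑ i, τ i / (∑ j, τ j) * f i y + η := fun η hη => by
      have h := hpos (fun i => f i y - c + η) ⟨y, fun i => by linarith⟩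
      have e : ∑ i, τ i * (f i y - c + η) = ∑ i, τ i * f i y + (∑ i, τ i) * (η - c) := by
        rw [sum_mul, ← sum_add_distrib]; exact sum_congr rfl fun i _ => by ring
      have e2 : ∑ i, τ i / (∑ j, τ j) * f i y = (∑ i, τ i * f i y) / ∑ j, τ j := by
        rw [sum_div]; exact sum_congr rfl fun i _ => by ring
      rw [e] at h
      have h3 := div_pos h hT
      rw [add_div, mul_div_cancel_left₀ _ hT.ne', ← e2] at h3
      linarith
    exact le_of_forall_pos_le_add hη

/-- A subset of `ℓ^p` that lies in no closed ball of `p`-th power radius `C` has a finite subset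
with the same property. -/
lemma exists_finset_forall_exists_lt_norm_sub_rpow {P : ℝ≥0∞} (hP : 0 < P.toReal)
    {A : Set (lp (fun _ : ℕ => ℝ) P)} {C : ℝ}
    (h : ∀ y, ∃ x ∈ A, C < ‖x - y‖ ^ P.toReal) :
    ∃ F : Finset (lp (fun _ : ℕ => ℝ) P), ↑F ⊆ A ∧ ∀ y, ∃ x ∈ F, C < ‖x - y‖ ^ P.toReal := by
  classical
  obtain ⟨x₀, hx₀, -⟩ := h 0
  set p := P.toReal
  let K : lp (fun _ : ℕ => ℝ) P → Set (ℕ → ℝ) := fun x =>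
    {y | ∀ s : Finset ℕ, ∑ k ∈ s, |x k - y k| ^ p ≤ C}
  have hK : ∀ x, IsClosed (K x) := fun x => by
    simp only [K, Set.ofPred_forall]
    refine isClosed_iInter fun s => isClosed_le ?_ continuous_const
    exact continuous_finsetSum _ fun k _ =>
      (continuous_const.sub (continuous_apply k)).abs.rpow_const fun _ => Or.inr hP.le
  let T : Set (ℕ → ℝ) := Set.univ.pi fun k => Metric.closedBall (x₀ k) (C ^ p⁻¹)
  have hT : IsCompact T := isCompact_univ_pi fun k => isCompact_closedBall _ _
  have hKT : K x₀ ⊆ T := fun y hy k _ => by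
    have h1 : |x₀ k - y k| ^ p ≤ C := by simpa using hy {k}
    rw [Metric.mem_closedBall, dist_comm, Real.dist_eq]
    exact (Real.le_rpow_inv_iff_of_pos (abs_nonneg _)
      ((Real.rpow_nonneg (abs_nonneg _) _).trans h1) hP).2 h1
  have hempty : T ∩ ⋂ x : A, K x = ∅ := by
    refine Set.eq_empty_of_forall_notMem fun y hy => ?_
    have hyK : ∀ x ∈ A, y ∈ K x := fun x hx => Set.mem_iInter.1 hy.2 ⟨x, hx⟩
    let w : lp (fun _ : ℕ => ℝ) P := ⟨fun k => x₀ k - y k, memℓp_gen' (hyK x₀ hx₀)⟩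
    obtain ⟨x, hx, hlt⟩ := h (x₀ - w)
    refine hlt.not_ge (hasSum_le_of_sum_le (lp.hasSum_norm hP _) fun s => ?_)
    have e : ∀ k, (x - (x₀ - w)) k = x k - y k := fun k =>
      congrArg (x k - ·) (sub_sub_cancel (x₀ k) (y k))
    simp only [e]
    exact hyK x hx s
  obtain ⟨u, hu⟩ := hT.elim_finite_subfamily_closed _ (fun x : A => hK x) hempty
  refine ⟨insert x₀ (u.image Subtype.val), ?_, fun y => ?_⟩
  · intro x hx
    simp only [Finset.coe_insert, Finset.coe_image, Set.mem_insert_iff, Set.mem_image] at hx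
    rcases hx with rfl | ⟨z, -, rfl⟩
    exacts [hx₀, z.2]
  · by_contra! hcon
    have hmem : ∀ x ∈ insert x₀ (u.image Subtype.val), (y : ℕ → ℝ) ∈ K x := fun x hx s => by
      simpa using (lp.sum_rpow_le_norm_rpow hP (x - y) s).trans (hcon x hx)
    refine (Set.eq_empty_iff_forall_notMem.1 hu y) ⟨hKT (hmem _ (Finset.mem_insert_self _ _)), ?_⟩
    exact Set.mem_iInter₂.2 fun x hx =>
      hmem _ (Finset.mem_insert_of_mem (Finset.mem_image_of_mem _ hx))

lemma convexOn_norm_sub_rpow {E : Type*} [NormedAddCommGroup E] [NormedSpace ℝ E] {p : ℝ}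
    (hp : 1 ≤ p) (x : E) : ConvexOn ℝ Set.univ fun y => ‖x - y‖ ^ p := by
  refine ⟨convex_univ, fun y _ z _ a b ha hb hab => ?_⟩
  have e : x - (a • y + b • z) = a • (x - y) + b • (x - z) := by
    rw [smul_sub, smul_sub, sub_add_sub_comm, ← add_smul, hab, one_smul]
  have h1 : ‖x - (a • y + b • z)‖ ≤ a * ‖x - y‖ + b * ‖x - z‖ := by
    rw [e]
    refine (norm_add_le _ _).trans_eq ?_
    rw [norm_smul, norm_smul, Real.norm_of_nonneg ha, Real.norm_of_nonneg hb]
  exact (Real.rpow_le_rpow (norm_nonneg _) h1 (by linarith)).trans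
    ((convexOn_rpow hp).2 (norm_nonneg _) (norm_nonneg _) ha hb hab)

/-- The weighted Jung inequality in `ℓ^p`, `1 < p ≤ 2`. -/
lemma exists_two_mul_sum_norm_sub_rpow_le {P : ℝ≥0∞} (hP1 : 1 < P.toReal) (hP2 : P.toReal ≤ 2)
    {ι : Type*} [Fintype ι] {t : ι → ℝ} (ht : ∀ i, 0 ≤ t i) (ht1 : ∑ i, t i = 1)
    (x : ι → lp (fun _ : ℕ => ℝ) P) :
    ∃ y, 2 * ∑ i, t i * ‖x i - y‖ ^ P.toReal ≤
      2 ^ (2 - P.toReal) * ∑ i, ∑ j, t i * t j * ‖x i - x j‖ ^ P.toReal := by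
  have hP : 0 < P.toReal := by linarith
  have hs : 0 < P.toReal - 1 := by linarith
  choose y hy hy0 using fun k => exists_sum_signedRpow_sub_eq_zero hs ht fun i => x i k
  have hmem : Memℓp y P := by
    have habs : ∀ i, Memℓp (fun k => |x i k|) P := fun i => by
      have := lp.memℓp (x i)
      rw [memℓp_gen_iff hP] at this ⊢
      simpa using this
    have hsum := Memℓp.finsetSum Finset.univ fun i _ => habs i
    rw [memℓp_gen_iff hP] at hsum ⊢
    refine Summable.of_nonneg_of_le (fun k => by positivity) (fun k => ?_) hsum
    refine Real.rpow_le_rpow (norm_nonneg _) ?_ hP.le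
    exact (hy k).trans (le_abs_self _)
  let y' : lp (fun _ : ℕ => ℝ) P := ⟨y, hmem⟩
  have hy' : ∀ i, HasSum (fun k => |x i k - y k| ^ P.toReal) (‖x i - y'‖ ^ P.toReal) := fun i =>
    lp.hasSum_norm hP (x i - y')
  have hx : ∀ i j, HasSum (fun k => |x i k - x j k| ^ P.toReal) (‖x i - x j‖ ^ P.toReal) :=
    fun i j => lp.hasSum_norm hP (x i - x j)
  have hl := (hasSum_sum fun i (_ : i ∈ Finset.univ) => (hy' i).mul_left (t i)).mul_left 2
  have hr := (hasSum_sum fun i (_ : i ∈ Finset.univ) => hasSum_sum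
    fun j (_ : j ∈ Finset.univ) => (hx i j).mul_left (t i * t j)).mul_left (2 ^ (2 - P.toReal))
  refine ⟨y', hasSum_le (fun k => ?_) hl hr⟩
  have := sum_mul_sum_rpow_abs_sub_ge hs (by linarith) ht ht1 (hy0 k)
  have e : 1 - (P.toReal - 1) = 2 - P.toReal := by ring
  simpa only [sub_add_cancel, sub_sub_sub_cancel_right, e] using this

lemma chebRadius_le {P : ℝ≥0∞} [Fact (1 ≤ P)] {A : Set (lp (fun _ : ℕ => ℝ) P)}
    (hA : A.Nonempty) {y : lp (fun _ : ℕ => ℝ) P} {c : ℝ} (h : ∀ x ∈ A, ‖x - y‖ ≤ c) :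
    chebRadius A ≤ c := by
  have := hA.to_subtype
  refine (ciInf_le ⟨0, ?_⟩ y).trans (ciSup_le fun x => h x x.2)
  rintro _ ⟨z, rfl⟩
  exact Real.iSup_nonneg fun _ => norm_nonneg _

theorem extremal_simplex_small_p (p q : ℝ) (hp1 : 1 < p) (hp2 : p ≤ 2)
    (hq : q = p / (p - 1)) [Fact (1 ≤ ENNReal.ofReal p)]
    (A : Set (lp (fun _ : ℕ => ℝ) (ENNReal.ofReal p)))
    (hbdd : Bornology.IsBounded A)
    (htwo : ∃ a ∈ A, ∃ b ∈ A, a ≠ b)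
    (hext : chebRadius A = 2 ^ (-(1 / q)) * Metric.diam A)
    (ε : ℝ) (hε0 : 0 < ε) (hε1 : ε < Metric.diam A)
    (m : ℕ) (hm : 0 < m) :
    ∃ z : Fin (m + 1) → lp (fun _ : ℕ => ℝ) (ENNReal.ofReal p),
      (∀ i, z i ∈ A) ∧
      ∀ i j, i ≠ j → Metric.diam A - ε ≤ ‖z i - z j‖ := by
  classical
  have hp0 : 0 < p := by linarith
  have hpR : (ENNReal.ofReal p).toReal = p := ENNReal.toReal_ofReal hp0.le
  obtain ⟨a₀, ha₀, b₀, hb₀, hab⟩ := htwo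
  set d := Metric.diam A
  have hd : 0 < d := hε0.trans hε1
  have hdist : ∀ x ∈ A, ∀ y ∈ A, ‖x - y‖ ≤ d := fun x hx y hy => by
    rw [← dist_eq_norm]; exact Metric.dist_le_diam_of_mem hbdd hx hy
  set D := d ^ p - (d - ε) ^ p
  have hD : 0 < D := sub_pos.2 (Real.rpow_lt_rpow (by linarith) (by linarith) hp0)
  set β : ℝ := 1 / (m + 2)
  have hβ : 0 < β := by positivity
  have hmβ : ((m + 1 : ℕ) : ℝ) * β < 1 := by
    push_cast
    rw [mul_one_div, div_lt_one (by positivity)]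
    linarith
  have hrad : chebRadius A ^ p = 2 ^ (1 - p) * d ^ p := by
    rw [hext, Real.mul_rpow (by positivity) hd.le, ← Real.rpow_mul (by norm_num), hq]
    congr 2
    field_simp
    ring
  set C := 2 ^ (1 - p) * (d ^ p - D * β ^ 2)
  have hC : C < chebRadius A ^ p := by
    rw [hrad]
    exact mul_lt_mul_of_pos_left (by linarith [mul_pos hD (pow_pos hβ 2)]) (by positivity)
  have hfar : ∀ y, ∃ x ∈ A, C < ‖x - y‖ ^ (ENNReal.ofReal p).toReal := fun y => by
    by_contra! hcon
    rw [hpR] at hcon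
    have hC0 : 0 ≤ C := (Real.rpow_nonneg (norm_nonneg _) _).trans (hcon a₀ ha₀)
    have hle : chebRadius A ≤ C ^ p⁻¹ := chebRadius_le ⟨a₀, ha₀⟩ fun x hx =>
      (Real.le_rpow_inv_iff_of_pos (norm_nonneg _) hC0 hp0).2 (hcon x hx)
    have hr0 : 0 ≤ chebRadius A := by rw [hext]; positivity
    exact hC.not_ge ((Real.le_rpow_inv_iff_of_pos hr0 hC0 hp0).1 hle)
  obtain ⟨F, hFA, hF⟩ := exists_finset_forall_exists_lt_norm_sub_rpow (by rwa [hpR]) hfar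
  simp only [hpR] at hF
  let v : F → lp (fun _ : ℕ => ℝ) (ENNReal.ofReal p) := Subtype.val
  have hv : ∀ i, v i ∈ A := fun i => hFA i.2
  obtain ⟨t, ht, ht1, htC⟩ := exists_convex_combination_ge
    (fun i => convexOn_norm_sub_rpow hp1.le (v i)) (c := C) fun y => by
      obtain ⟨x, hx, hlt⟩ := hF y
      exact ⟨⟨x, hx⟩, hlt⟩
  obtain ⟨y, hy⟩ := exists_two_mul_sum_norm_sub_rpow_le (by rwa [hpR]) (by rwa [hpR]) ht ht1 v
  rw [hpR] at hy
  have hlower : d ^ p - D * β ^ 2 ≤ ∑ i, ∑ j, t i * t j * ‖v i - v j‖ ^ p := by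
    have h2 : 2 * C = 2 ^ (2 - p) * (d ^ p - D * β ^ 2) := by
      have : (2 : ℝ) ^ (2 - p) = 2 * 2 ^ (1 - p) := by
        rw [show 2 - p = 1 + (1 - p) by ring, Real.rpow_add (by norm_num), Real.rpow_one]
      rw [this, mul_assoc]
    refine le_of_mul_le_mul_left ?_ (by positivity : (0 : ℝ) < 2 ^ (2 - p))
    rw [← h2]
    exact (mul_le_mul_of_nonneg_left (htC y) (by norm_num)).trans hy
  let bad : F → F → Prop := fun i j => ‖v i - v j‖ < d - ε
  have hbad : ∑ i, ∑ j, t i * t j * (if bad i j then 1 else 0) ≤ β ^ 2 := by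
    have hupper : ∑ i, ∑ j, t i * t j * ‖v i - v j‖ ^ p ≤
        ∑ i, ∑ j, t i * t j * (d ^ p - D * (if bad i j then 1 else 0)) := by
      refine Finset.sum_le_sum fun i _ => Finset.sum_le_sum fun j _ =>
        mul_le_mul_of_nonneg_left ?_ (mul_nonneg (ht i) (ht j))
      split_ifs with hij
      · rw [mul_one, sub_sub_cancel]
        exact Real.rpow_le_rpow (norm_nonneg _) hij.le hp0.le
      · rw [mul_zero, sub_zero]
        exact Real.rpow_le_rpow (norm_nonneg _) (hdist _ (hv i) _ (hv j)) hp0.le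
    have e : ∑ i, ∑ j, t i * t j * (d ^ p - D * (if bad i j then 1 else 0)) =
        d ^ p - D * ∑ i, ∑ j, t i * t j * (if bad i j then 1 else 0) := by
      simp only [mul_sub, Finset.sum_sub_distrib, ← Finset.sum_mul, ← Finset.mul_sum, ht1, mul_one,
        one_mul, mul_left_comm _ D]
    rw [e] at hupper
    exact le_of_mul_le_mul_left (by linarith) hD
  obtain ⟨z, hz⟩ := exists_pairwise_not_of_weight_le ht ht1 bad
    (fun i j hij => by simpa only [bad, norm_sub_rev] using hij) hβ hbad (m + 1) hmβ
  exact ⟨fun i => v (z i), fun i => hv (z i), fun i j hij => not_lt.1 (hz i j hij)⟩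
end

section
/- Let p be a real number with p > 2. Let A be a bounded subset of ℓ^p containing at least two points which is extremal, i.e. r(A) = 2^(−1/p) · d(A). Then for every ε with 0 < ε < d(A) and every positive integer m, there exist points z_1, …, z_{m+1} ∈ A such that ‖z_i − z_j‖ ≥ d(A) − ε for all i ≠ j (i.e. A contains the vertex set of an m-simplex each of whose edges has length at least d(A) − ε). -/
open scoped ENNReal

theorem sum_mul_comp_max_le {ι : Type*} (S : Finset ι) (w a : ι → ℝ) {g : ℝ → ℝ}
    (hg : MonotoneOn g (Set.Ici 0))
    (ha : ∀ i ∈ S, 0 ≤ a i) {M : ℝ} (hM0 : 0 ≤ M) (hM : ∀ i ∈ S, a i ≤ M) :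
    ∑ i ∈ S, ∑ j ∈ S, w i * w j * g (max (a i) (a j)) ≤ g M * (∑ i ∈ S, w i) ^ 2 := by
  classical
  induction S using Finset.induction_on_max_value a generalizing M with
  | empty => simp
  | @insert k S hk hmax ih =>
    simp only [Finset.mem_insert, forall_eq_or_imp] at ha hM
    have h := ih ha.2 ha.1 hmax
    have h1 : ∑ j ∈ S, w k * w j * g (max (a k) (a j)) = g (a k) * w k * ∑ j ∈ S, w j := by
      rw [Finset.mul_sum]
      refine Finset.sum_congr rfl fun j hj => ?_
      rw [max_eq_left (hmax j hj)]; ring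
    have h2 : ∑ i ∈ S, w i * w k * g (max (a i) (a k)) = g (a k) * w k * ∑ j ∈ S, w j := by
      rw [Finset.mul_sum]
      refine Finset.sum_congr rfl fun j hj => ?_
      rw [max_eq_right (hmax j hj)]; ring
    simp only [Finset.sum_insert hk, Finset.sum_add_distrib, max_self, h1, h2]
    have h3 := mul_le_mul_of_nonneg_right (hg ha.1 hM0 hM.1) (sq_nonneg (w k + ∑ j ∈ S, w j))
    nlinarith

theorem one_add_rpow_add_mul_le {p u : ℝ} (hp : 2 ≤ p) (hu : 0 ≤ u) :
    1 + u ^ p + p * u ≤ (1 + u) ^ p := by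
  have hd : ∀ x : ℝ, 0 < x → HasDerivAt (fun u : ℝ => (1 + u) ^ p - (1 + u ^ p + p * u))
      (p * ((1 + x) ^ (p - 1) - (1 + x ^ (p - 1)))) x := by
    intro x hx
    have h1 := ((hasDerivAt_id x).const_add 1).rpow_const (p := p) (Or.inr (by linarith))
    have h2 := Real.hasDerivAt_rpow_const (x := x) (p := p) (Or.inr (by linarith))
    have h3 := (hasDerivAt_id x).const_mul p
    refine (h1.sub ((h2.const_add 1).add h3)).congr_deriv ?_
    simp only [id]; ring
  have hmono : MonotoneOn (fun u : ℝ => (1 + u) ^ p - (1 + u ^ p + p * u)) (Set.Ici 0) := by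
    apply monotoneOn_of_deriv_nonneg (convex_Ici 0)
    · have h1 : Continuous fun u : ℝ => (1 + u) ^ p :=
        (by fun_prop : Continuous fun u : ℝ => 1 + u).rpow_const fun _ => Or.inr (by linarith)
      have h2 : Continuous fun u : ℝ => u ^ p :=
        continuous_id.rpow_const fun _ => Or.inr (by linarith)
      exact Continuous.continuousOn (by fun_prop)
    · intro x hx
      rw [interior_Ici] at hx
      exact (hd x hx).differentiableAt.differentiableWithinAt
    · intro x hx
      rw [interior_Ici] at hx
      rw [(hd x hx).deriv]
      have := Real.add_rpow_le_rpow_add zero_le_one (le_of_lt hx) (by linarith : 1 ≤ p - 1)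
      rw [Real.one_rpow] at this
      exact mul_nonneg (by linarith) (by linarith)
  have := hmono Set.self_mem_Ici (Set.mem_Ici.2 hu) hu
  simp [Real.zero_rpow (by linarith : p ≠ 0)] at this
  linarith

theorem one_add_rpow_sub_mul_le {p u : ℝ} (hp : 2 ≤ p) (hu : 0 ≤ u) (hu1 : u ≤ 1) :
    1 + u ^ p - p * u ≤ (1 - u) ^ p := by
  have hd : ∀ x : ℝ, HasDerivAt (fun u : ℝ => (1 - u) ^ p - (1 + u ^ p - p * u))
      (p * (1 - ((1 - x) ^ (p - 1) + x ^ (p - 1)))) x := by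
    intro x
    have h1 := ((hasDerivAt_id x).const_sub 1).rpow_const (p := p) (Or.inr (by linarith))
    have h2 := Real.hasDerivAt_rpow_const (x := x) (p := p) (Or.inr (by linarith))
    have h3 := (hasDerivAt_id x).const_mul p
    refine (h1.sub ((h2.const_add 1).sub h3)).congr_deriv ?_
    simp only [id]; ring
  have hmono : MonotoneOn (fun u : ℝ => (1 - u) ^ p - (1 + u ^ p - p * u)) (Set.Icc 0 1) := by
    apply monotoneOn_of_deriv_nonneg (convex_Icc 0 1)
    · exact fun x _ => (hd x).continuousAt.continuousWithinAt
    · exact fun x _ => (hd x).differentiableAt.differentiableWithinAt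
    · intro x hx
      rw [interior_Icc] at hx
      rw [(hd x).deriv]
      have := Real.add_rpow_le_rpow_add (by linarith [hx.2] : 0 ≤ 1 - x) hx.1.le
        (by linarith : 1 ≤ p - 1)
      rw [sub_add_cancel, Real.one_rpow] at this
      exact mul_nonneg (by linarith) (by linarith)
  have := hmono (Set.left_mem_Icc.2 zero_le_one) ⟨hu, hu1⟩ hu
  simp [Real.zero_rpow (by linarith : p ≠ 0)] at this
  linarith

theorem one_add_abs_rpow_sub_mul_le {p u : ℝ} (hp : 2 ≤ p) (hu : |u| ≤ 1) :
    1 + |u| ^ p - p * u ≤ |1 - u| ^ p := by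
  obtain ⟨h1, h2⟩ := abs_le.1 hu
  rw [abs_of_nonneg (by linarith : 0 ≤ 1 - u)]
  rcases le_total 0 u with h | h
  · rw [abs_of_nonneg h]
    exact one_add_rpow_sub_mul_le hp h h2
  · rw [abs_of_nonpos h]
    have := one_add_rpow_add_mul_le hp (neg_nonneg.2 h)
    rw [← sub_eq_add_neg] at this
    linarith

theorem abs_rpow_add_abs_rpow_sub_le {p : ℝ} (hp : 2 < p) (x y : ℝ) :
    |x| ^ p + |y| ^ p - p * (x * y * max |x| |y| ^ (p - 2)) ≤ |x - y| ^ p := by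
  wlog h : |y| ≤ |x| generalizing x y
  · have := this y x (le_of_not_ge h)
    rw [abs_sub_comm, max_comm, mul_comm y x] at this
    linarith
  rcases eq_or_ne x 0 with rfl | hx
  · have hy : y = 0 := by simpa using h
    subst hy
    simp [Real.zero_rpow (by linarith : p ≠ 0)]
  have hx' : 0 < |x| := abs_pos.2 hx
  have key := one_add_abs_rpow_sub_mul_le hp.le (u := y / x)
    (by rw [abs_div]; exact div_le_one_of_le₀ h hx'.le)
  have hpos : 0 < |x| ^ p := Real.rpow_pos_of_pos hx' p
  have key2 := mul_le_mul_of_nonneg_left key hpos.le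
  have e1 : |x| ^ p * |1 - y / x| ^ p = |x - y| ^ p := by
    rw [← Real.mul_rpow hx'.le (abs_nonneg _), ← abs_mul]
    congr 2; field_simp
  have e2 : |x| ^ p * |y / x| ^ p = |y| ^ p := by
    rw [← Real.mul_rpow hx'.le (abs_nonneg _), ← abs_mul]
    congr 2; field_simp
  have e3 : |x| ^ p = |x| ^ (p - 2) * x ^ 2 := by
    rw [← sq_abs x, ← Real.rpow_natCast, ← Real.rpow_add hx']; simp
  have e4 : |x| ^ p * (p * (y / x)) = p * (x * y * |x| ^ (p - 2)) := by
    rw [e3]; field_simp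
  rw [max_eq_left h]
  rw [e1] at key2
  calc _ = |x| ^ p * (1 + |y / x| ^ p - p * (y / x)) := by
        rw [mul_sub, mul_add, e2, e4, mul_one]
    _ ≤ _ := key2

theorem two_mul_sum_abs_sub_mean_rpow_le {ι : Type*} {p : ℝ} (hp : 2 < p) (S : Finset ι)
    (t x : ι → ℝ) (ht : ∀ i ∈ S, 0 ≤ t i) (ht1 : ∑ i ∈ S, t i = 1) :
    2 * ∑ i ∈ S, t i * |x i - ∑ j ∈ S, t j * x j| ^ p ≤
      ∑ i ∈ S, ∑ j ∈ S, t i * t j * |x i - x j| ^ p := by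
  set c := ∑ j ∈ S, t j * x j with hc
  set y : ι → ℝ := fun i => x i - c
  have hw : ∑ i ∈ S, t i * y i = 0 := by
    simp only [y, mul_sub, Finset.sum_sub_distrib, ← Finset.sum_mul, ht1, ← hc, one_mul, sub_self]
  have hcross : ∑ i ∈ S, ∑ j ∈ S, t i * y i * (t j * y j) * max |y i| |y j| ^ (p - 2) ≤ 0 := by
    have := sum_mul_comp_max_le S (fun i => t i * y i) (fun i => |y i|)
      (g := fun s => s ^ (p - 2)) (M := ∑ i ∈ S, |y i|)
      (Real.monotoneOn_rpow_Ici_of_exponent_nonneg (by linarith))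
      (fun _ _ => abs_nonneg _) (Finset.sum_nonneg fun _ _ => abs_nonneg _)
      (fun i hi => Finset.single_le_sum (f := fun i => |y i|) (fun _ _ => abs_nonneg _) hi)
    simpa [hw] using this
  have hpt : ∑ i ∈ S, ∑ j ∈ S, (t i * t j * |y i| ^ p + t i * t j * |y j| ^ p
      - p * (t i * y i * (t j * y j) * max |y i| |y j| ^ (p - 2))) ≤
      ∑ i ∈ S, ∑ j ∈ S, t i * t j * |x i - x j| ^ p := by
    refine Finset.sum_le_sum fun i hi => Finset.sum_le_sum fun j hj => ?_
    have h := mul_le_mul_of_nonneg_left (abs_rpow_add_abs_rpow_sub_le hp (y i) (y j))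
      (mul_nonneg (ht i hi) (ht j hj))
    have e : y i - y j = x i - x j := by simp only [y]; ring
    rw [e] at h
    linarith
  have h1 : ∑ i ∈ S, ∑ j ∈ S, t i * t j * |y i| ^ p = ∑ i ∈ S, t i * |y i| ^ p := by
    refine Finset.sum_congr rfl fun i _ => ?_
    rw [← Finset.sum_mul, ← Finset.mul_sum, ht1, mul_one]
  have h2 : ∑ i ∈ S, ∑ j ∈ S, t i * t j * |y j| ^ p = ∑ i ∈ S, t i * |y i| ^ p := by
    rw [Finset.sum_comm, ← h1]
    exact Finset.sum_congr rfl fun i _ => Finset.sum_congr rfl fun j _ => by ring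
  simp only [Finset.sum_sub_distrib, Finset.sum_add_distrib, h1, h2, ← Finset.mul_sum] at hpt
  have := mul_nonpos_of_nonneg_of_nonpos (by linarith : 0 ≤ p) hcross
  linarith

theorem abs_half_add_rpow_add_abs_half_sub_rpow_le {p : ℝ} (hp : 2 ≤ p) (a b : ℝ) :
    |(1 / 2) * (a + b)| ^ p + |(1 / 2) * (a - b)| ^ p ≤ (|a| ^ p + |b| ^ p) / 2 := by
  have hsq : ∀ x : ℝ, |x| ^ p = (x ^ 2) ^ (p / 2) := fun x => by
    rw [← sq_abs, ← Real.rpow_natCast, ← Real.rpow_mul (abs_nonneg x)]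
    congr 1; push_cast; ring
  simp only [hsq]
  have h1 := Real.add_rpow_le_rpow_add (sq_nonneg (1 / 2 * (a + b))) (sq_nonneg (1 / 2 * (a - b)))
    (by linarith : 1 ≤ p / 2)
  have h2 := (convexOn_rpow (by linarith : 1 ≤ p / 2)).2 (Set.mem_Ici.2 (sq_nonneg a))
    (Set.mem_Ici.2 (sq_nonneg b)) (by norm_num : (0 : ℝ) ≤ 1 / 2) (by norm_num : (0 : ℝ) ≤ 1 / 2)
    (by norm_num)
  simp only [smul_eq_mul] at h2
  refine h1.trans ?_
  convert h2 using 1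
  · congr 1; ring
  · ring

theorem lp_hasSum_abs_rpow {p : ℝ} (hp : 0 < p) (x : lp (fun _ : ℕ => ℝ) (ENNReal.ofReal p)) :
    HasSum (fun k => |x k| ^ p) (‖x‖ ^ p) := by
  have h := lp.hasSum_norm (by rwa [ENNReal.toReal_ofReal hp.le]) x
  simpa only [ENNReal.toReal_ofReal hp.le, Real.norm_eq_abs] using h

theorem lp_clarkson {p : ℝ} [Fact (1 ≤ ENNReal.ofReal p)] (hp : 2 ≤ p)
    (a b : lp (fun _ : ℕ => ℝ) (ENNReal.ofReal p)) :
    ‖(1 / 2 : ℝ) • (a + b)‖ ^ p + ‖(1 / 2 : ℝ) • (a - b)‖ ^ p ≤ (‖a‖ ^ p + ‖b‖ ^ p) / 2 := by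
  have hp0 : 0 < p := by linarith
  refine hasSum_le (fun k => ?_)
    ((lp_hasSum_abs_rpow hp0 _).add (lp_hasSum_abs_rpow hp0 _))
    (((lp_hasSum_abs_rpow hp0 a).add (lp_hasSum_abs_rpow hp0 b)).div_const 2)
  exact abs_half_add_rpow_add_abs_half_sub_rpow_le hp (a k) (b k)

theorem lp_two_mul_sum_norm_sub_mean_rpow_le {ι : Type*} {p : ℝ} [Fact (1 ≤ ENNReal.ofReal p)]
    (hp : 2 < p) (S : Finset ι) (t : ι → ℝ) (x : ι → lp (fun _ : ℕ => ℝ) (ENNReal.ofReal p))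
    (ht : ∀ i ∈ S, 0 ≤ t i) (ht1 : ∑ i ∈ S, t i = 1) :
    2 * ∑ i ∈ S, t i * ‖x i - ∑ j ∈ S, t j • x j‖ ^ p ≤
      ∑ i ∈ S, ∑ j ∈ S, t i * t j * ‖x i - x j‖ ^ p := by
  have hp0 : 0 < p := by linarith
  refine hasSum_le (fun k => ?_)
    ((hasSum_sum fun i _ => (lp_hasSum_abs_rpow hp0 _).mul_left _).mul_left _)
    (hasSum_sum fun i _ => hasSum_sum fun j _ => (lp_hasSum_abs_rpow hp0 _).mul_left _)
  have := two_mul_sum_abs_sub_mean_rpow_le hp S t (fun i => x i k) ht ht1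
  have hk : (∑ j ∈ S, t j • x j) k = ∑ j ∈ S, t j * x j k := by
    rw [lp.coeFn_sum]
    exact Finset.sum_apply k S fun j => ⇑(t j • x j)
  simpa only [lp.coeFn_sub, Pi.sub_apply, hk] using this

/-- `μ` is a finitely supported probability weight on `A`. -/
structure IsFinProb {E : Type*} (A : Set E) (μ : E →₀ ℝ) : Prop where
  support_subset : ∀ x ∈ μ.support, x ∈ A
  nonneg : ∀ x, 0 ≤ μ x
  sum_eq_one : μ.sum (fun _ t => t) = 1

namespace IsFinProb

variable {E : Type*} {A : Set E} {μ : E →₀ ℝ}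

theorem single {a : E} (ha : a ∈ A) : IsFinProb A (Finsupp.single a 1) where
  support_subset x hx := by
    classical
    have := Finsupp.support_single_subset hx
    rw [Finset.mem_singleton] at this
    exact this ▸ ha
  nonneg x := by
    classical
    rw [Finsupp.single_apply]; split_ifs <;> norm_num
  sum_eq_one := by simp

theorem mix (hμ : IsFinProb A μ) {x : E} (hx : x ∈ A) {s : ℝ} (hs0 : 0 ≤ s) (hs1 : s ≤ 1) :
    IsFinProb A ((1 - s) • μ + s • Finsupp.single x 1) where
  support_subset y hy := by
    classical
    rcases Finset.mem_union.1 (Finsupp.support_add hy) with h | h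
    · exact hμ.support_subset y (Finsupp.support_smul h)
    · exact (single hx).support_subset y (Finsupp.support_smul h)
  nonneg y := by
    have := mul_nonneg (sub_nonneg.2 hs1) (hμ.nonneg y)
    have := mul_nonneg hs0 ((single hx).nonneg y)
    simp only [Finsupp.add_apply, Finsupp.smul_apply, smul_eq_mul]
    linarith
  sum_eq_one := by
    have h : ∀ ν : E →₀ ℝ, ν.sum (fun _ t => t) =
        Finsupp.linearCombination ℝ (fun _ : E => (1 : ℝ)) ν := by
      intro ν; simp [Finsupp.linearCombination_apply]
    have h1 := hμ.sum_eq_one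
    rw [h] at h1 ⊢
    simp [h1]

theorem sum_mono (hμ : IsFinProb A μ) {f g : E → ℝ} (h : ∀ x ∈ A, f x ≤ g x) :
    Finsupp.linearCombination ℝ f μ ≤ Finsupp.linearCombination ℝ g μ := by
  simp only [Finsupp.linearCombination_apply]
  exact Finset.sum_le_sum fun x hx =>
    mul_le_mul_of_nonneg_left (h x (hμ.support_subset x hx)) (hμ.nonneg x)

theorem sum_const (hμ : IsFinProb A μ) (c : ℝ) :
    Finsupp.linearCombination ℝ (fun _ : E => c) μ = c := by
  simp only [Finsupp.linearCombination_apply, smul_eq_mul]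
  rw [Finsupp.sum, ← Finset.sum_mul]
  have := hμ.sum_eq_one
  rw [Finsupp.sum] at this
  rw [this, one_mul]

theorem exists_lt_of_sum_lt (hμ : IsFinProb A μ) {f : E → ℝ} {c : ℝ}
    (h : Finsupp.linearCombination ℝ f μ < c) : ∃ x ∈ A, f x < c := by
  by_contra! hc
  have := hμ.sum_mono hc
  rw [hμ.sum_const] at this
  linarith

theorem exists_pairwise_lt {h : E → E → ℝ} (hμ : IsFinProb A μ)
    (h0 : ∀ x ∈ A, ∀ y ∈ A, 0 ≤ h x y) {κ : ℝ} (hκ : 0 < κ) (n : ℕ)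
    (hE : Finsupp.linearCombination ℝ (fun x => Finsupp.linearCombination ℝ (h x) μ) μ
      < κ / (4 * (n + 1))) :
    ∃ z : ℕ → E, (∀ i < n, z i ∈ A) ∧ ∀ j < n, ∀ i < j, h (z i) (z j) < κ := by
  set f : E → ℝ := fun x => Finsupp.linearCombination ℝ (h x) μ with hf
  have hn : (0 : ℝ) < n + 1 := by positivity
  have hf0 : ∀ x ∈ A, 0 ≤ f x := fun x hx => by
    rw [← hμ.sum_const 0]
    exact hμ.sum_mono (h0 x hx)
  suffices H : ∀ k ≤ n, ∃ z : ℕ → E, (∀ i < k, z i ∈ A) ∧ (∀ i < k, f (z i) < κ / (2 * (n + 1))) ∧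
      ∀ j < k, ∀ i < j, h (z i) (z j) < κ by
    obtain ⟨z, h1, -, h2⟩ := H n le_rfl
    exact ⟨z, h1, h2⟩
  intro k
  induction k with
  | zero =>
    intro _
    obtain ⟨x, -, -⟩ := hμ.exists_lt_of_sum_lt hE
    exact ⟨fun _ => x, by simp⟩
  | succ k ih =>
    intro hk
    obtain ⟨z, hzA, hzf, hz⟩ := ih (by omega)
    have hlin : Finsupp.linearCombination ℝ
        (fun x => ∑ i ∈ Finset.range k, h (z i) x + 2 * (n + 1) * f x) μ =
        ∑ i ∈ Finset.range k, f (z i) + 2 * (n + 1) * Finsupp.linearCombination ℝ f μ := by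
      simp only [hf, Finsupp.linearCombination_apply, Finsupp.sum, smul_eq_mul, mul_add,
        Finset.sum_add_distrib, Finset.mul_sum]
      rw [Finset.sum_comm]
      congr 1
      refine Finset.sum_congr rfl fun x _ => Finset.sum_congr rfl fun y _ => by ring
    have hsum : ∑ i ∈ Finset.range k, f (z i) ≤ κ / 2 := by
      calc ∑ i ∈ Finset.range k, f (z i) ≤ ∑ i ∈ Finset.range k, κ / (2 * (n + 1)) :=
            Finset.sum_le_sum fun i hi => (hzf i (Finset.mem_range.1 hi)).le
        _ = k * (κ / (2 * (n + 1))) := by simp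
        _ ≤ (n + 1) * (κ / (2 * (n + 1))) := by
            have : (k : ℝ) ≤ n := by exact_mod_cast (by omega : k ≤ n)
            gcongr; linarith
        _ = κ / 2 := by field_simp
    have hE' : 2 * (n + 1) * Finsupp.linearCombination ℝ f μ < κ / 2 := by
      calc _ < 2 * (n + 1) * (κ / (4 * (n + 1))) := by gcongr
        _ = κ / 2 := by field_simp; norm_num
    obtain ⟨x, hxA, hx⟩ := hμ.exists_lt_of_sum_lt (lt_of_eq_of_lt hlin
      (by linarith : _ < κ))
    have hterm : ∀ i ∈ Finset.range k, 0 ≤ h (z i) x := fun i hi =>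
      h0 _ (hzA i (Finset.mem_range.1 hi)) _ hxA
    have hfx := hf0 x hxA
    refine ⟨Function.update z k x, ?_, ?_, ?_⟩
    · intro i hi
      rcases eq_or_ne i k with rfl | hik
      · simpa
      · rw [Function.update_of_ne hik]; exact hzA i (by omega)
    · intro i hi
      rcases eq_or_ne i k with rfl | hik
      · rw [Function.update_self, lt_div_iff₀ (by positivity)]
        have := Finset.sum_nonneg hterm
        linarith
      · rw [Function.update_of_ne hik]; exact hzf i (by omega)
    · intro j hj i hij
      rw [Function.update_of_ne (by omega : i ≠ k)]
      rcases eq_or_ne j k with rfl | hjk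
      · rw [Function.update_self]
        have h1 := Finset.single_le_sum hterm (Finset.mem_range.2 hij)
        have : 0 ≤ 2 * (n + 1) * f x := by positivity
        linarith
      · rw [Function.update_of_ne hjk]; exact hz j (by omega) i hij

end IsFinProb

/-- Minimax for the Chebyshev radius under a Clarkson-type inequality. -/
theorem exists_isFinProb_forall_le {E : Type*} [NormedAddCommGroup E] [NormedSpace ℝ E] {p : ℝ}
    (hp : 0 < p)
    (hC : ∀ a b : E, ‖(1 / 2 : ℝ) • (a + b)‖ ^ p + ‖(1 / 2 : ℝ) • (a - b)‖ ^ p ≤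
      (‖a‖ ^ p + ‖b‖ ^ p) / 2)
    {A : Set E} (hne : A.Nonempty) (hbdd : Bornology.IsBounded A) {r : ℝ} (hr0 : 0 ≤ r)
    (hr : ∀ y, ∀ s < r, ∃ x ∈ A, s < ‖x - y‖) {v : ℝ} (hv : v < r ^ p) :
    ∃ μ, IsFinProb A μ ∧ ∀ y, v ≤ Finsupp.linearCombination ℝ (fun x => ‖x - y‖ ^ p) μ := by
  set V : Set ℝ := {v | ∃ μ, IsFinProb A μ ∧
    ∀ y, v ≤ Finsupp.linearCombination ℝ (fun x => ‖x - y‖ ^ p) μ} with hV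
  obtain ⟨a, ha⟩ := hne
  have h0V : (0 : ℝ) ∈ V := ⟨_, .single ha, fun y => by
    simp only [Finsupp.linearCombination_single, one_smul]; positivity⟩
  have hVb : BddAbove V := by
    refine ⟨Metric.diam A ^ p, ?_⟩
    rintro v ⟨μ, hμ, h⟩
    refine (h a).trans ?_
    rw [← hμ.sum_const (Metric.diam A ^ p)]
    refine hμ.sum_mono fun x hx => ?_
    rw [← dist_eq_norm]
    exact Real.rpow_le_rpow dist_nonneg (Metric.dist_le_diam_of_mem hbdd hx ha) hp.le
  set D := sSup V with hD
  have hD0 : 0 ≤ D := le_csSup hVb h0V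
  suffices H : r ≤ D ^ (1 / p) by
    have h1 : r ^ p ≤ D := by
      calc r ^ p ≤ (D ^ (1 / p)) ^ p := Real.rpow_le_rpow hr0 H hp.le
        _ = D := by rw [← Real.rpow_mul hD0, one_div_mul_cancel hp.ne', Real.rpow_one]
    obtain ⟨w, ⟨μ, hμ, h⟩, hw⟩ := exists_lt_of_lt_csSup ⟨0, h0V⟩ (hv.trans_le h1)
    exact ⟨μ, hμ, fun y => hw.le.trans (h y)⟩
  have hnear : ∀ μ, IsFinProb A μ → ∀ η > 0,
      ∃ y, Finsupp.linearCombination ℝ (fun x => ‖x - y‖ ^ p) μ ≤ D + η := by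
    intro μ hμ η hη
    by_contra! hc
    have := le_csSup hVb ⟨μ, hμ, fun y => (hc y).le⟩
    linarith
  have step : ∀ s : ℝ, 0 < s → s < 1 → r ≤ s + (D + 2 * s) ^ (1 / p) +
      2 * (((D + s ^ 2) + (D + s ^ 2) / (1 - s)) / 2 - (D - s ^ 2)) ^ (1 / p) := by
    intro s hs0 hs1
    have hs2 : 0 < s ^ 2 := by positivity
    have hs' : 0 < 1 - s := by linarith
    obtain ⟨w, ⟨μ, hμ, hw⟩, hwD⟩ := exists_lt_of_lt_csSup ⟨0, h0V⟩
      (by linarith : D - s ^ 2 < sSup V)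
    obtain ⟨y, hy⟩ := hnear μ hμ _ hs2
    obtain ⟨x, hxA, hx⟩ := hr y (r - s) (by linarith)
    obtain ⟨y', hy'⟩ := hnear _ (hμ.mix hxA hs0.le hs1.le) _ hs2
    simp only [map_add, map_smul, Finsupp.linearCombination_single, smul_eq_mul, one_mul] at hy'
    have hwy' := hw y'
    have h1 : ‖x - y'‖ ^ p ≤ D + 2 * s := by
      refine le_of_mul_le_mul_left ?_ hs0
      have := mul_le_mul_of_nonneg_left (hwD.le.trans hwy') hs'.le
      nlinarith [mul_pos hs0 hs2]
    have h2 : Finsupp.linearCombination ℝ (fun x => ‖x - y'‖ ^ p) μ ≤ (D + s ^ 2) / (1 - s) := by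
      rw [le_div_iff₀ hs']
      have : 0 ≤ s * ‖x - y'‖ ^ p := by positivity
      linarith
    have h3 : Finsupp.linearCombination ℝ (fun x => ‖x - (1 / 2 : ℝ) • (y + y')‖ ^ p) μ +
        ‖(1 / 2 : ℝ) • (y' - y)‖ ^ p ≤
        (Finsupp.linearCombination ℝ (fun x => ‖x - y‖ ^ p) μ +
          Finsupp.linearCombination ℝ (fun x => ‖x - y'‖ ^ p) μ) / 2 := by
      have := hμ.sum_mono (f := fun x => ‖x - (1 / 2 : ℝ) • (y + y')‖ ^ p +
        ‖(1 / 2 : ℝ) • (y' - y)‖ ^ p) (g := fun x => (‖x - y‖ ^ p + ‖x - y'‖ ^ p) / 2)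
        fun x _ => by
          have := hC (x - y) (x - y')
          rwa [show (1 / 2 : ℝ) • (x - y + (x - y')) = x - (1 / 2 : ℝ) • (y + y') by module,
            show x - y - (x - y') = y' - y by abel] at this
      have hc := hμ.sum_const (‖(1 / 2 : ℝ) • (y' - y)‖ ^ p)
      simp only [Finsupp.linearCombination_apply, Finsupp.sum, smul_eq_mul, mul_add,
        Finset.sum_add_distrib, mul_div_assoc', ← Finset.sum_div] at this hc ⊢
      linarith
    have h4 : ‖(1 / 2 : ℝ) • (y' - y)‖ ^ p ≤
        ((D + s ^ 2) + (D + s ^ 2) / (1 - s)) / 2 - (D - s ^ 2) := by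
      have := hw ((1 / 2 : ℝ) • (y + y'))
      linarith
    have root : ∀ {u b : ℝ}, 0 ≤ u → u ^ p ≤ b → u ≤ b ^ (1 / p) := fun {u b} hu hub => by
      calc u = (u ^ p) ^ (1 / p) := by
            rw [← Real.rpow_mul hu, mul_one_div_cancel hp.ne', Real.rpow_one]
        _ ≤ _ := Real.rpow_le_rpow (by positivity) hub (by positivity)
    have h5 := root (norm_nonneg _) h1
    have h6 := root (norm_nonneg _) h4
    rw [norm_smul, Real.norm_of_nonneg (by norm_num)] at h6
    have h7 := norm_add_le (x - y') (y' - y)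
    rw [sub_add_sub_cancel] at h7
    linarith
  have hcont : ContinuousAt (fun s : ℝ => s + (D + 2 * s) ^ (1 / p) +
      2 * (((D + s ^ 2) + (D + s ^ 2) / (1 - s)) / 2 - (D - s ^ 2)) ^ (1 / p)) 0 := by
    have e : (0 : ℝ) ≤ 1 / p := by positivity
    refine (continuousAt_id.add (ContinuousAt.rpow_const (by fun_prop) (Or.inr e))).add
      (continuousAt_const.mul (ContinuousAt.rpow_const ?_ (Or.inr e)))
    have : (1 : ℝ) - 0 ≠ 0 := by norm_num
    fun_prop (disch := assumption)
  have hlim := hcont.tendsto.mono_left (nhdsWithin_le_nhds (s := Set.Ioi 0))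
  have := ge_of_tendsto hlim (b := r) (by
    filter_upwards [Ioo_mem_nhdsGT (zero_lt_one' ℝ)] with s hs using step s hs.1 hs.2)
  simpa [Real.zero_rpow (inv_ne_zero hp.ne')] using this

theorem extremal_simplex_large_p (p : ℝ) (hp : 2 < p) [Fact (1 ≤ ENNReal.ofReal p)]
    (A : Set (lp (fun _ : ℕ => ℝ) (ENNReal.ofReal p)))
    (hbdd : Bornology.IsBounded A)
    (htwo : ∃ a ∈ A, ∃ b ∈ A, a ≠ b)
    (hext : chebRadius A = 2 ^ (-(1 / p)) * Metric.diam A)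
    (ε : ℝ) (hε0 : 0 < ε) (hε1 : ε < Metric.diam A)
    (m : ℕ) (hm : 0 < m) :
    ∃ z : Fin (m + 1) → lp (fun _ : ℕ => ℝ) (ENNReal.ofReal p),
      (∀ i, z i ∈ A) ∧
      ∀ i j, i ≠ j → Metric.diam A - ε ≤ ‖z i - z j‖ := by
  set d := Metric.diam A with hd
  have hp0 : 0 < p := by linarith
  obtain ⟨a, ha, -⟩ := htwo
  have hd0 : 0 < d := hε0.trans hε1
  have hdist : ∀ x ∈ A, ∀ y ∈ A, ‖x - y‖ ≤ d := fun x hx y hy => by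
    rw [← dist_eq_norm]; exact Metric.dist_le_diam_of_mem hbdd hx hy
  have hr : ∀ y, ∀ s < chebRadius A, ∃ x ∈ A, s < ‖x - y‖ := by
    intro y s hs
    have hle : chebRadius A ≤ ⨆ x : A, ‖(x : lp (fun _ : ℕ => ℝ) (ENNReal.ofReal p)) - y‖ :=
      ciInf_le ⟨0, by rintro _ ⟨y, rfl⟩; exact Real.iSup_nonneg fun _ => norm_nonneg _⟩ y
    have : Nonempty A := ⟨⟨a, ha⟩⟩
    obtain ⟨x, hx⟩ := exists_lt_of_lt_ciSup (hs.trans_le hle)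
    exact ⟨x, x.2, hx⟩
  have hrp : chebRadius A ^ p = d ^ p / 2 := by
    rw [hext, Real.mul_rpow (by positivity) hd0.le, ← Real.rpow_mul (by norm_num), neg_mul,
      one_div_mul_cancel hp0.ne', Real.rpow_neg_one]
    ring
  have hκ : 0 < d ^ p - (d - ε) ^ p :=
    sub_pos.2 (Real.rpow_lt_rpow (by linarith) (by linarith) hp0)
  set κ := d ^ p - (d - ε) ^ p with hκdef
  obtain ⟨μ, hμ, hv⟩ := exists_isFinProb_forall_le hp0 (lp_clarkson hp.le) ⟨a, ha⟩ hbdd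
    (by rw [hext]; positivity) hr (v := d ^ p / 2 - κ / (16 * ((m + 1 : ℕ) + 1)))
    (by rw [hrp]; exact sub_lt_self _ (by positivity))
  have hJ := lp_two_mul_sum_norm_sub_mean_rpow_le hp μ.support μ id (fun x _ => hμ.nonneg x)
    hμ.sum_eq_one
  have hv' := hv (∑ x ∈ μ.support, μ x • x)
  have hE : Finsupp.linearCombination ℝ (fun x => Finsupp.linearCombination ℝ
      (fun y => d ^ p - ‖x - y‖ ^ p) μ) μ =
      d ^ p - ∑ x ∈ μ.support, ∑ y ∈ μ.support, μ x * μ y * ‖x - y‖ ^ p := by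
    have hc := hμ.sum_const (d ^ p)
    simp only [Finsupp.linearCombination_apply, Finsupp.sum, smul_eq_mul, mul_sub,
      Finset.sum_sub_distrib, Finset.mul_sum, ← mul_assoc] at hc ⊢
    congr 1
    simp only [mul_assoc, ← Finset.mul_sum, hc]
  obtain ⟨z, hzA, hz⟩ := hμ.exists_pairwise_lt (h := fun x y => d ^ p - ‖x - y‖ ^ p)
    (fun x hx y hy => sub_nonneg.2 (Real.rpow_le_rpow (norm_nonneg _) (hdist x hx y hy) hp0.le))
    hκ (m + 1) (by
      rw [hE]
      simp only [Finsupp.linearCombination_apply, Finsupp.sum, smul_eq_mul, id] at hv' hJ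
      have h1 : κ / (4 * ((m + 1 : ℕ) + 1)) = 4 * (κ / (16 * ((m + 1 : ℕ) + 1))) := by
        field_simp; norm_num
      have h2 : 0 < κ / (16 * ((m + 1 : ℕ) + 1)) := by positivity
      linarith)
  have hlow : ∀ j < m + 1, ∀ i < j, d - ε ≤ ‖z i - z j‖ := fun j hj i hij => by
    have := hz j hj i hij
    exact (Real.rpow_le_rpow_iff (by linarith) (norm_nonneg _) hp0).1 (by linarith)
  refine ⟨fun i => z i, fun i => hzA i i.2, fun i j hij => ?_⟩
  rcases lt_or_gt_of_ne hij with h | h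
  · exact hlow j j.2 i h
  · rw [norm_sub_rev]
    exact hlow i i.2 j h
end
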